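/- Suppose 1 < n < m − 1. Then the Vietoris–Rips complex VR(F_n^m, 2) is homotopy equivalent to a wedge sum of Σ_{k=2}^{n} (m+k−1−n choose k+1)·(k choose 2) copies of the 2-sphere S². -/

import Mathlib

open Finset

/-- An abstract simplicial complex on a vertex type `V`: a collection of nonempty
finite subsets of `V` (the faces), closed under taking nonempty subsets. -/
structure AbsSC (V : Type) where
  faces : Set (Finset V)
  not_empty_mem : ∅ ∉ faces
  down_closed : ∀ s ∈ faces, ∀ t : Finset V, t ⊆ s → t ≠ ∅ → t ∈ faces

namespace AbsSC

variable {V W : Type}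

/-- The vertex set of a simplicial complex. -/
def vertices (K : AbsSC V) : Set V := {v | ({v} : Finset V) ∈ K.faces}

/-- The geometric realization of a simplicial complex: the space of convex weightings
supported on a face, topologized as a subspace of `V → ℝ`. -/
def space (K : AbsSC V) : Type :=
  {f : V → ℝ // (∀ v, 0 ≤ f v) ∧ ∃ s ∈ K.faces, (∀ v, f v ≠ 0 → v ∈ s) ∧ ∑ v ∈ s, f v = 1}

instance (K : AbsSC V) : TopologicalSpace K.space := by unfold space; infer_instance

/-- `L` is a subcomplex of `K`. -/
def IsSubcomplex (L K : AbsSC V) : Prop := L.faces ⊆ K.faces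

/-- Homotopy equivalence of simplicial complexes (of their geometric realizations). -/
def HEquiv (K : AbsSC V) (L : AbsSC W) : Prop :=
  Nonempty (ContinuousMap.HomotopyEquiv K.space L.space)

/-- The realization of `K` is homotopy equivalent to the topological space `X`. -/
def HEquivTop (K : AbsSC V) (X : Type) [TopologicalSpace X] : Prop :=
  Nonempty (ContinuousMap.HomotopyEquiv K.space X)

/-- The inclusion of realizations induced by a subcomplex inclusion. -/
def incl {L K : AbsSC V} (h : L.faces ⊆ K.faces) : C(L.space, K.space) where
  toFun f := ⟨f.1, f.2.1, by obtain ⟨s, hs, h1, h2⟩ := f.2.2; exact ⟨s, h hs, h1, h2⟩⟩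
  continuous_toFun := Continuous.subtype_mk continuous_subtype_val _

variable [DecidableEq V]

/-- The link of a vertex. -/
def link (K : AbsSC V) (v : V) : AbsSC V where
  faces := {σ | σ ≠ ∅ ∧ v ∉ σ ∧ σ ∪ {v} ∈ K.faces}
  not_empty_mem h := h.1 rfl
  down_closed := by
    rintro s ⟨hne, hv, hs⟩ t hts htne
    exact ⟨htne, fun hvt => hv (hts hvt),
      K.down_closed _ hs _ (Finset.union_subset_union hts (Finset.Subset.refl _)) (by simp [Finset.union_eq_empty])⟩

lemma link_subset (K : AbsSC V) (v : V) : (K.link v).faces ⊆ K.faces := by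
  rintro σ ⟨hne, hv, hσ⟩
  exact K.down_closed _ hσ _ Finset.subset_union_left hne

/-- The complex induced on the vertices other than `v`. -/
def delete (K : AbsSC V) (v : V) : AbsSC V where
  faces := {σ | σ ∈ K.faces ∧ v ∉ σ}
  not_empty_mem h := K.not_empty_mem h.1
  down_closed := by
    rintro s ⟨hs, hv⟩ t hts htne
    exact ⟨K.down_closed _ hs _ hts htne, fun h => hv (hts h)⟩

/-- The star of a vertex: `st_K(v) = {σ : σ ∪ {v} ∈ K}`. -/
def star (K : AbsSC V) (v : V) : AbsSC V where
  faces := {σ | σ ≠ ∅ ∧ σ ∪ {v} ∈ K.faces}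
  not_empty_mem h := h.1 rfl
  down_closed := by
    rintro s ⟨hne, hs⟩ t hts htne
    exact ⟨htne,
      K.down_closed _ hs _ (Finset.union_subset_union hts (Finset.Subset.refl _)) (by simp [Finset.union_eq_empty])⟩

/-- The star cluster of a subcomplex `L` in `K`: the union of stars of vertices of `L`. -/
def starCluster (K L : AbsSC V) : AbsSC V where
  faces := {σ | σ ≠ ∅ ∧ ∃ v, ({v} : Finset V) ∈ L.faces ∧ σ ∪ {v} ∈ K.faces}
  not_empty_mem h := h.1 rfl
  down_closed := by
    rintro s ⟨hne, v, hvL, hs⟩ t hts htne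
    exact ⟨htne, v, hvL,
      K.down_closed _ hs _ (Finset.union_subset_union hts (Finset.Subset.refl _)) (by simp [Finset.union_eq_empty])⟩

/-- The union of two simplicial complexes. -/
def union (K₁ K₂ : AbsSC V) : AbsSC V where
  faces := K₁.faces ∪ K₂.faces
  not_empty_mem h := by
    rcases h with h | h
    exacts [K₁.not_empty_mem h, K₂.not_empty_mem h]
  down_closed := by
    rintro s (hs | hs) t hts htne
    exacts [Or.inl (K₁.down_closed _ hs _ hts htne), Or.inr (K₂.down_closed _ hs _ hts htne)]

/-- The union of a family of simplicial complexes. -/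
def iUnionC {ι : Type} (F : ι → AbsSC V) : AbsSC V where
  faces := ⋃ i, (F i).faces
  not_empty_mem h := by
    obtain ⟨i, hi⟩ := Set.mem_iUnion.mp h
    exact (F i).not_empty_mem hi
  down_closed := by
    intro s hs t hts htne
    obtain ⟨i, hi⟩ := Set.mem_iUnion.mp hs
    exact Set.mem_iUnion.mpr ⟨i, (F i).down_closed _ hi _ hts htne⟩

/-- The `n`-skeleton of a complex: all faces with at most `n+1` vertices. -/
def skeleton (K : AbsSC V) (n : ℕ) : AbsSC V where
  faces := {σ | σ ∈ K.faces ∧ σ.card ≤ n + 1}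
  not_empty_mem h := K.not_empty_mem h.1
  down_closed := by
    rintro s ⟨hs, hcard⟩ t hts htne
    exact ⟨K.down_closed _ hs _ hts htne, le_trans (Finset.card_le_card hts) hcard⟩

/-- The simplicial complex generated by a single simplex `s` (all its nonempty subsets). -/
def simplexCx (s : Finset V) : AbsSC V where
  faces := {t | t ≠ ∅ ∧ t ⊆ s}
  not_empty_mem h := h.1 rfl
  down_closed := by
    rintro a ⟨hne, has⟩ t hta htne
    exact ⟨htne, hta.trans has⟩

/-- A maximal simplex (facet) of `K`. -/
def IsFacet (K : AbsSC V) (σ : Finset V) : Prop :=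
  σ ∈ K.faces ∧ ∀ τ ∈ K.faces, σ ⊆ τ → τ = σ

/-- `K` is a clique complex: any nonempty set of vertices which pairwise span edges is a face. -/
def IsCliqueCx (K : AbsSC V) : Prop :=
  ∀ σ : Finset V, σ ≠ ∅ → (∀ v ∈ σ, ({v} : Finset V) ∈ K.faces) →
    (∀ v ∈ σ, ∀ w ∈ σ, v ≠ w → ({v, w} : Finset V) ∈ K.faces) → σ ∈ K.faces

/-- `L` is a full subcomplex of `K`. -/
def IsFull (L K : AbsSC V) : Prop :=
  ∀ σ ∈ K.faces, (∀ v ∈ σ, ({v} : Finset V) ∈ L.faces) → σ ∈ L.faces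

end AbsSC

noncomputable section

/-- The `n`-dimensional sphere. -/
abbrev Sph (n : ℕ) : Type := Metric.sphere (0 : EuclideanSpace ℝ (Fin (n + 1))) 1

/-- A base point on the sphere. -/
def sphBase (n : ℕ) : Sph n :=
  ⟨EuclideanSpace.single 0 1, by simp⟩

/-- Relation gluing the base points of `c` copies of a pointed space to an auxiliary point. -/
inductive wedgeRel (c : ℕ) (X : Type) (x₀ : X) : Unit ⊕ Fin c × X → Unit ⊕ Fin c × X → Prop
  | glue (i : Fin c) : wedgeRel c X x₀ (Sum.inl ()) (Sum.inr (i, x₀))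

/-- The wedge sum of `c` copies of the pointed space `(X, x₀)`. -/
def Wedge (c : ℕ) (X : Type) [TopologicalSpace X] (x₀ : X) : Type := Quot (wedgeRel c X x₀)

instance (c : ℕ) (X : Type) [TopologicalSpace X] (x₀ : X) : TopologicalSpace (Wedge c X x₀) := by
  unfold Wedge; infer_instance

/-- The base point of the wedge. -/
def wedgePt (c : ℕ) (X : Type) [TopologicalSpace X] (x₀ : X) : Wedge c X x₀ :=
  Quot.mk _ (Sum.inl ())

/-- The wedge sum of `c` copies of the `n`-sphere. -/
abbrev WedgeSph (n c : ℕ) : Type := Wedge c (Sph n) (sphBase n)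

/-- The base point of a wedge of spheres. -/
def wedgeSphPt (n c : ℕ) : WedgeSph n c := wedgePt c _ _

/-- Relation gluing the two base points in a binary wedge. -/
inductive wedge2Rel (X Y : Type) (x₀ : X) (y₀ : Y) : X ⊕ Y → X ⊕ Y → Prop
  | glue : wedge2Rel X Y x₀ y₀ (Sum.inl x₀) (Sum.inr y₀)

/-- The wedge sum `X ∨ Y` of two pointed spaces. -/
def Wedge2 (X Y : Type) [TopologicalSpace X] [TopologicalSpace Y] (x₀ : X) (y₀ : Y) : Type :=
  Quot (wedge2Rel X Y x₀ y₀)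

instance (X Y : Type) [TopologicalSpace X] [TopologicalSpace Y] (x₀ : X) (y₀ : Y) :
    TopologicalSpace (Wedge2 X Y x₀ y₀) := by unfold Wedge2; infer_instance

/-- Relation collapsing the top and bottom of the cylinder `X × [0,1]` to two cone points. -/
inductive suspRel (X : Type) : X × unitInterval ⊕ Bool → X × unitInterval ⊕ Bool → Prop
  | zero (x : X) : suspRel X (Sum.inl (x, 0)) (Sum.inr false)
  | one (x : X) : suspRel X (Sum.inl (x, 1)) (Sum.inr true)

/-- The (unreduced) suspension `Σ X`. -/
def Susp (X : Type) [TopologicalSpace X] : Type := Quot (suspRel X)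

instance (X : Type) [TopologicalSpace X] : TopologicalSpace (Susp X) := by
  unfold Susp; infer_instance

/-- The north cone point of the suspension. -/
def suspNorth (X : Type) [TopologicalSpace X] : Susp X := Quot.mk _ (Sum.inr true)

end

/-- The Vietoris–Rips complex at scale `r` of a collection `F` of finite subsets of `ℕ`,
with respect to the symmetric difference metric `d(A,B) = |A Δ B|`. -/
def VRc (F : Set (Finset ℕ)) (r : ℕ) : AbsSC (Finset ℕ) where
  faces := {σ | σ.Nonempty ∧ (∀ A ∈ σ, A ∈ F) ∧
    ∀ A ∈ σ, ∀ B ∈ σ, (symmDiff A B).card ≤ r}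
  not_empty_mem h := by simpa using h.1
  down_closed := by
    rintro s ⟨hne, hF, hd⟩ t hts htne
    exact ⟨Finset.nonempty_iff_ne_empty.mpr htne, fun A hA => hF A (hts hA),
      fun A hA B hB => hd A (hts hA) B (hts hB)⟩

/-- `F_n^m`: all `n`-element subsets of `[m] = {1, …, m}`. -/
def Fnm (m n : ℕ) : Set (Finset ℕ) := {A | A ⊆ Finset.Icc 1 m ∧ A.card = n}

/-- `F_{≤ n}^m`: all subsets of `[m]` of cardinality at most `n`. -/
def Fle (m n : ℕ) : Set (Finset ℕ) := {A | A ⊆ Finset.Icc 1 m ∧ A.card ≤ n}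

/-- The simplex `N[C] = {A : C ⊆ A, |A \ C| = 1}` inside `[m]`. -/
def NSimp (m : ℕ) (C : Finset ℕ) : Finset (Finset ℕ) :=
  (Finset.Icc 1 m \ C).image (fun x => insert x C)

/-- The simplex `L[S]`: all subsets of `S` obtained by removing one element. -/
def LSimp (S : Finset ℕ) : Finset (Finset ℕ) := S.image (fun x => S.erase x)

/-- The total order `≺`: first compare cardinalities, then compare the increasing
enumerations lexicographically. -/
def precLT (A B : Finset ℕ) : Prop :=
  A.card < B.card ∨
    (A.card = B.card ∧ List.Lex (· < ·) (A.sort (· ≤ ·)) (B.sort (· ≤ ·)))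

/-- `A ⪯ B`. -/
def precLE (A B : Finset ℕ) : Prop := precLT A B ∨ A = B

/-- `F^m_{≺ A}`: all subsets of `[m]` strictly preceding `A`. -/
def FprecLT (m : ℕ) (A : Finset ℕ) : Set (Finset ℕ) :=
  {B | B ⊆ Finset.Icc 1 m ∧ precLT B A}

/-- `F^m_{⪯ A}`: all subsets of `[m]` preceding (or equal to) `A`. -/
def FprecLE (m : ℕ) (A : Finset ℕ) : Set (Finset ℕ) :=
  {B | B ⊆ Finset.Icc 1 m ∧ precLE B A}

/-- The `j`-th value (0-indexed) of an enumeration `i : Fin n → ℕ`. -/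
def ith {n : ℕ} (i : Fin n → ℕ) (j : ℕ) : ℕ := if h : j < n then i ⟨j, h⟩ else 0

/-- The `ℓ`-th entry (1-indexed) of the enumeration, as an integer, with `i_0 = -1`. -/
def ivZ {n : ℕ} (i : Fin n → ℕ) (ℓ : ℕ) : ℤ := if ℓ = 0 then -1 else (ith i (ℓ - 1) : ℤ)

/-- For `B = i_1 i_2 ⋯ i_n` (increasing), with `d_1 = i_1` and
`d_ℓ = i_ℓ - (i_{ℓ-1} + 1)`, `r_B = Σ_{k=2}^{n-2} C(k,2) + Σ_{ℓ=1}^{n-2} d_ℓ·C(n-ℓ,2)`. -/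
def rA (B : Finset ℕ) : ℕ :=
  (∑ k ∈ Finset.Icc 2 (B.card - 2), Nat.choose k 2) +
    ∑ ℓ ∈ Finset.Icc 1 (B.card - 2),
      ((B.sort (· ≤ ·)).getD (ℓ - 1) 0 -
        (if ℓ = 1 then 0 else (B.sort (· ≤ ·)).getD (ℓ - 2) 0 + 1)) * Nat.choose (B.card - ℓ) 2

/-- For `B = i_1 i_2 ⋯ i_n` (increasing), with `c_1 = i_1 - 1` and
`c_ℓ = i_ℓ - (i_{ℓ-1} + 1)`, `s_B = Σ_{k=2}^{n-2} C(k,2) + Σ_{ℓ=1}^{n-2} c_ℓ·C(n-ℓ,2)`. -/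
def sA (B : Finset ℕ) : ℕ :=
  (∑ k ∈ Finset.Icc 2 (B.card - 2), Nat.choose k 2) +
    ∑ ℓ ∈ Finset.Icc 1 (B.card - 2),
      ((B.sort (· ≤ ·)).getD (ℓ - 1) 0 -
        (if ℓ = 1 then 1 else (B.sort (· ≤ ·)).getD (ℓ - 2) 0 + 1)) * Nat.choose (B.card - ℓ) 2

/-- `t_n = Σ_{A ⊆ [m], |A| = n} r_A`. -/
def tN (m n : ℕ) : ℕ :=
  ∑ A ∈ (Finset.Icc 1 m).powerset.filter (fun A => A.card = n), rA A

/-- `o_{m,n} = Σ { s_A : A ∈ F^m_{n+2}, min A ≥ 2 }`. -/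
def omn (m n : ℕ) : ℕ :=
  ∑ A ∈ (Finset.Icc 1 m).powerset.filter (fun A => A.card = n + 2 ∧ ∀ x ∈ A, 2 ≤ x), sA A

namespace JohnsonVR

/-- The sum of the coordinates of `x` over `A`. -/
def coordSum (x : ℕ → ℝ) (A : Finset ℕ) : ℝ := ∑ i ∈ A, x i

lemma coordSum_swap (x : ℕ → ℝ) {A : Finset ℕ} {q c : ℕ} (hq : q ∈ A) (hc : c ∉ A) :
    coordSum x (insert c (A.erase q)) = coordSum x A - x q + x c := by
  have h : c ∉ A.erase q := fun h => hc (mem_of_mem_erase h)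
  rw [coordSum, sum_insert h, coordSum, ← add_sum_erase A x hq]
  ring

lemma swap_mem_powersetCard {J A : Finset ℕ} {n q c : ℕ} (hA : A ∈ J.powersetCard n)
    (hq : q ∈ A) (hc : c ∉ A) (hcJ : c ∈ J) : insert c (A.erase q) ∈ J.powersetCard n := by
  rw [mem_powersetCard] at hA ⊢
  refine ⟨insert_subset hcJ ((erase_subset _ _).trans hA.1), ?_⟩
  have h : c ∉ A.erase q := fun h => hc (mem_of_mem_erase h)
  rw [card_insert_of_notMem h, card_erase_of_mem hq, hA.2]
  have := card_pos.2 ⟨q, hq⟩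
  omega

noncomputable section

/-- The minimum of `x` over `C` (zero when `C` is empty). -/
def minCoord (C : Finset ℕ) (x : ℕ → ℝ) : ℝ := if h : C.Nonempty then C.inf' h x else 0

lemma continuous_minCoord (C : Finset ℕ) : Continuous (minCoord C) := by
  unfold minCoord
  by_cases h : C.Nonempty
  · simp only [h, dite_true]
    exact Continuous.finset_inf'_apply h fun i _ => continuous_apply i
  · simp only [h, dite_false]
    exact continuous_const

/-- The `k`-th largest coordinate of `x` with index in `J`. -/
def orderStat (J : Finset ℕ) (k : ℕ) (x : ℕ → ℝ) : ℝ :=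
  if h : (J.powersetCard k).Nonempty then (J.powersetCard k).sup' h (fun C => minCoord C x) else 0

lemma continuous_orderStat (J : Finset ℕ) (k : ℕ) : Continuous (orderStat J k) := by
  unfold orderStat
  by_cases h : (J.powersetCard k).Nonempty
  · simp only [h, dite_true]
    exact Continuous.finset_sup'_apply h fun C _ => continuous_minCoord C
  · simp only [h, dite_false]
    exact continuous_const

lemma exists_orderStat_le {J : Finset ℕ} {k : ℕ} (hk : k ≤ J.card) (x : ℕ → ℝ) :
    ∃ C ∈ J.powersetCard k, ∀ c ∈ C, orderStat J k x ≤ x c := by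
  have h : (J.powersetCard k).Nonempty := powersetCard_nonempty.2 hk
  obtain ⟨C, hC, e⟩ := exists_mem_eq_sup' h (fun C => minCoord C x)
  refine ⟨C, hC, fun c hc => ?_⟩
  rw [orderStat, dif_pos h, e, minCoord, dif_pos ⟨c, hc⟩]
  exact inf'_le _ hc

lemma exists_le_orderStat {J C : Finset ℕ} {k : ℕ} (hk : 0 < k) (hC : C ∈ J.powersetCard k)
    (x : ℕ → ℝ) : ∃ c ∈ C, x c ≤ orderStat J k x := by
  have hne : C.Nonempty := card_pos.1 (by rw [(mem_powersetCard.1 hC).2]; exact hk)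
  obtain ⟨c, hc, e⟩ := exists_mem_eq_inf' hne x
  refine ⟨c, hc, ?_⟩
  rw [orderStat, dif_pos ⟨C, hC⟩]
  refine le_trans ?_ (le_sup' (fun C => minCoord C x) hC)
  rw [minCoord, dif_pos hne, e]

/-- The `(n - 1)`-st largest coordinate. -/
def upperLevel (J : Finset ℕ) (n : ℕ) (x : ℕ → ℝ) : ℝ := orderStat J (n - 1) x

/-- The `(n + 2)`-nd largest coordinate. -/
def lowerLevel (J : Finset ℕ) (n : ℕ) (x : ℕ → ℝ) : ℝ := - orderStat J (J.card - n - 1) (-x)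

/-- Half of the difference between the `(n - 1)`-st and the `(n + 2)`-nd largest coordinate. -/
def halfGap (J : Finset ℕ) (n : ℕ) (x : ℕ → ℝ) : ℝ := (upperLevel J n x - lowerLevel J n x) / 2

/-- The largest sum of `n` coordinates. -/
def maxSum (J : Finset ℕ) (n : ℕ) (x : ℕ → ℝ) : ℝ :=
  if h : (J.powersetCard n).Nonempty then (J.powersetCard n).sup' h (coordSum x) else 0

/-- Unnormalised weight of an `n`-set: positive iff its coordinate sum is nearly maximal. -/
def rawWeight (J : Finset ℕ) (n : ℕ) (x : ℕ → ℝ) (A : Finset ℕ) : ℝ :=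
  max 0 (coordSum x A - maxSum J n x + halfGap J n x)

lemma continuous_upperLevel (J : Finset ℕ) (n : ℕ) : Continuous (upperLevel J n) :=
  continuous_orderStat _ _

lemma continuous_lowerLevel (J : Finset ℕ) (n : ℕ) : Continuous (lowerLevel J n) :=
  ((continuous_orderStat _ _).comp continuous_neg).neg

lemma continuous_maxSum (J : Finset ℕ) (n : ℕ) : Continuous (maxSum J n) := by
  unfold maxSum
  by_cases h : (J.powersetCard n).Nonempty
  · simp only [h, dite_true]
    exact Continuous.finset_sup'_apply h fun C _ =>
      continuous_finsetSum _ fun i _ => continuous_apply i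
  · simp only [h, dite_false]
    exact continuous_const

lemma continuous_rawWeight (J : Finset ℕ) (n : ℕ) (A : Finset ℕ) :
    Continuous fun x => rawWeight J n x A := by
  unfold rawWeight halfGap coordSum
  have := continuous_maxSum J n
  have := continuous_upperLevel J n
  have := continuous_lowerLevel J n
  fun_prop

lemma coordSum_le_maxSum {J A : Finset ℕ} {n : ℕ} (hA : A ∈ J.powersetCard n) (x : ℕ → ℝ) :
    coordSum x A ≤ maxSum J n x := by
  rw [maxSum, dif_pos ⟨A, hA⟩]
  exact le_sup' (coordSum x) hA

/-- The points for which some `n - 1` coordinates exceed all but two of the others. -/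
def cone (J C S : Finset ℕ) : Set (ℕ → ℝ) := {x | ∀ c ∈ C, ∀ q ∈ J \ S, x q < x c}

lemma convex_cone (J C S : Finset ℕ) : Convex ℝ (cone J C S) := by
  intro x hx y hy a b ha hb hab c hc q hq
  have h1 := hx c hc q hq
  have h2 := hy c hc q hq
  simp only [Pi.add_apply, Pi.smul_apply, smul_eq_mul]
  rcases eq_or_lt_of_le ha with h | h
  · have : b = 1 := by linarith
    subst this; subst h; linarith
  · have := mul_lt_mul_of_pos_left h1 h
    have := mul_le_mul_of_nonneg_left h2.le hb
    linarith

/-- The union of the cones: the `(n - 1)`-st largest coordinate exceeds the `(n + 2)`-nd. -/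
def gapSet (J : Finset ℕ) (n : ℕ) : Set (ℕ → ℝ) :=
  {x | ∃ C S : Finset ℕ, C ⊆ S ∧ S ⊆ J ∧ C.card = n - 1 ∧ S.card = n + 1 ∧ x ∈ cone J C S}

end

end JohnsonVR

namespace JohnsonVR

lemma lowerLevel_lt_upperLevel {J : Finset ℕ} {n : ℕ} {x : ℕ → ℝ} (h1 : 1 < n)
    (h2 : n + 1 < J.card) (hx : x ∈ gapSet J n) : lowerLevel J n x < upperLevel J n x := by
  obtain ⟨C, S, hCS, hSJ, hC, hS, h⟩ := hx
  obtain ⟨q, hq, hq'⟩ := exists_le_orderStat (J := J) (C := J \ S) (k := J.card - n - 1) (by omega)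
    (by rw [mem_powersetCard]; exact ⟨sdiff_subset, by rw [card_sdiff_of_subset hSJ]; omega⟩) (-x)
  obtain ⟨c, hc, hc'⟩ := exists_le_orderStat (J := J) (C := C) (k := n - 1) (by omega)
    (by rw [mem_powersetCard]; exact ⟨hCS.trans hSJ, hC⟩) x
  have := h c hc q hq
  simp only [Pi.neg_apply] at hq'
  unfold lowerLevel upperLevel
  linarith

/-- A maximiser of the coordinate sum, with a smallest element inside and a largest outside. -/
lemma exists_sorted {J : Finset ℕ} {n : ℕ} (h1 : 1 < n) (h2 : n + 1 < J.card) (x : ℕ → ℝ) :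
    ∃ A ∈ J.powersetCard n, ∃ i ∈ A, ∃ j ∈ J, j ∉ A ∧ maxSum J n x = coordSum x A ∧ x j ≤ x i ∧
      (∀ c ∈ A.erase i, upperLevel J n x ≤ x c) ∧
      (∀ q ∈ J \ insert j A, x q ≤ lowerLevel J n x) := by
  have hne : (J.powersetCard n).Nonempty := powersetCard_nonempty.2 (by omega)
  obtain ⟨A, hA, e⟩ := exists_mem_eq_sup' hne (coordSum x)
  have hA' := mem_powersetCard.1 hA
  have hAne : A.Nonempty := card_pos.1 (by omega)
  have hcard : (J \ A).card = J.card - n := by rw [card_sdiff_of_subset hA'.1, hA'.2]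
  obtain ⟨i, hi, hmin⟩ := exists_min_image A x hAne
  obtain ⟨j, hj, hmax⟩ := exists_max_image (J \ A) x (card_pos.1 (by omega))
  rw [mem_sdiff] at hj
  have hM : maxSum J n x = coordSum x A := by rw [maxSum, dif_pos hne, e]
  have hji : x j ≤ x i := by
    have := coordSum_le_maxSum (swap_mem_powersetCard hA hi hj.2 hj.1) x
    rw [coordSum_swap x hi hj.2] at this
    linarith
  refine ⟨A, hA, i, hi, j, hj.1, hj.2, hM, hji, fun c hc => ?_, fun q hq => ?_⟩
  · by_contra! hlt
    obtain ⟨C, hC, hCx⟩ := exists_orderStat_le (J := J) (k := n - 1) (by omega) x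
    rw [mem_powersetCard] at hC
    have hsub : C ⊆ (A.erase i).erase c := by
      intro k hk
      have hk1 : upperLevel J n x ≤ x k := hCx k hk
      have hic := hmin c (mem_of_mem_erase hc)
      have hkA : k ∈ A := by
        by_contra hkA
        have := hmax k (mem_sdiff.2 ⟨hC.1 hk, hkA⟩)
        linarith
      refine mem_erase.2 ⟨?_, mem_erase.2 ⟨?_, hkA⟩⟩ <;> rintro rfl <;> linarith
    have := card_le_card hsub
    rw [card_erase_of_mem hc, card_erase_of_mem hi, hA'.2, hC.2] at this
    omega
  · by_contra! hlt
    obtain ⟨C, hC, hCx⟩ := exists_orderStat_le (J := J) (k := J.card - n - 1) (by omega) (-x)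
    rw [mem_powersetCard] at hC
    rw [mem_sdiff, mem_insert, not_or] at hq
    have hqA : q ∈ J \ A := mem_sdiff.2 ⟨hq.1, hq.2.2⟩
    have hsub : C ⊆ ((J \ A).erase j).erase q := by
      intro k hk
      have hk1 : x k ≤ lowerLevel J n x := by
        have := hCx k hk
        simp only [Pi.neg_apply] at this
        unfold lowerLevel
        linarith
      have hjq := hmax q hqA
      have hkA : k ∉ A := by
        intro hkA
        have := hmin k hkA
        linarith
      refine mem_erase.2 ⟨?_, mem_erase.2 ⟨?_, mem_sdiff.2 ⟨hC.1 hk, hkA⟩⟩⟩ <;> rintro rfl <;>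
        linarith
    have := card_le_card hsub
    rw [card_erase_of_mem (mem_erase.2 ⟨hq.2.1, hqA⟩), card_erase_of_mem (mem_sdiff.2 hj), hcard,
      hC.2] at this
    omega

lemma rawWeight_pos_iff {J : Finset ℕ} {n : ℕ} {x : ℕ → ℝ} {A : Finset ℕ} :
    0 < rawWeight J n x A ↔ maxSum J n x < coordSum x A + halfGap J n x := by
  unfold rawWeight
  rw [lt_max_iff]
  constructor
  · rintro (h | h) <;> linarith
  · intro h; right; linarith

lemma rawWeight_nonneg (J : Finset ℕ) (n : ℕ) (x : ℕ → ℝ) (A : Finset ℕ) :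
    0 ≤ rawWeight J n x A := le_max_left _ _

lemma card_symmDiff_le_of_subset {n : ℕ} {A B C : Finset ℕ} (hC : C.card = n - 1) (hA : A.card = n)
    (hB : B.card = n) (hCA : C ⊆ A) (hCB : C ⊆ B) : (symmDiff A B).card ≤ 2 := by
  have h : symmDiff A B ⊆ (A \ C) ∪ (B \ C) := by
    intro k hk
    rw [mem_symmDiff] at hk
    rw [mem_union, mem_sdiff, mem_sdiff]
    rcases hk with hk | hk
    · exact Or.inl ⟨hk.1, fun h => hk.2 (hCB h)⟩
    · exact Or.inr ⟨hk.1, fun h => hk.2 (hCA h)⟩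
  have := (card_le_card h).trans (card_union_le _ _)
  rw [card_sdiff_of_subset hCA, card_sdiff_of_subset hCB] at this
  omega

lemma card_symmDiff_le_of_superset {n : ℕ} {A B S : Finset ℕ} (hS : S.card = n + 1)
    (hA : A.card = n) (hB : B.card = n) (hAS : A ⊆ S) (hBS : B ⊆ S) :
    (symmDiff A B).card ≤ 2 := by
  have h : symmDiff A B ⊆ (S \ A) ∪ (S \ B) := by
    intro k hk
    rw [mem_symmDiff] at hk
    rw [mem_union, mem_sdiff, mem_sdiff]
    rcases hk with hk | hk
    · exact Or.inr ⟨hAS hk.1, hk.2⟩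
    · exact Or.inl ⟨hBS hk.1, hk.2⟩
  have := (card_le_card h).trans (card_union_le _ _)
  rw [card_sdiff_of_subset hAS, card_sdiff_of_subset hBS] at this
  omega

lemma rawWeight_eq_zero_of_swap {J A : Finset ℕ} {n q c : ℕ} {x : ℕ → ℝ}
    (hlt : lowerLevel J n x < upperLevel J n x)
    (hA : A ∈ J.powersetCard n) (hq : q ∈ A) (hc : c ∉ A) (hcJ : c ∈ J)
    (hqx : x q ≤ lowerLevel J n x) (hcx : upperLevel J n x ≤ x c) : ¬ 0 < rawWeight J n x A := by
  rw [rawWeight_pos_iff, halfGap]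
  have := coordSum_le_maxSum (swap_mem_powersetCard hA hq hc hcJ) x
  rw [coordSum_swap x hq hc] at this
  linarith

lemma card_symmDiff_le_of_rawWeight_pos {J A B : Finset ℕ} {n : ℕ} {x : ℕ → ℝ} (h1 : 1 < n)
    (h2 : n + 1 < J.card) (hx : x ∈ gapSet J n) (hA : A ∈ J.powersetCard n)
    (hB : B ∈ J.powersetCard n) (hwA : 0 < rawWeight J n x A) (hwB : 0 < rawWeight J n x B) :
    (symmDiff A B).card ≤ 2 := by
  have hlt := lowerLevel_lt_upperLevel h1 h2 hx
  obtain ⟨D, hD, i, hi, j, hj, hjD, hM, hji, hup, hlow⟩ := exists_sorted h1 h2 x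
  have hD' := mem_powersetCard.1 hD
  have hC : (D.erase i).card = n - 1 := by rw [card_erase_of_mem hi, hD'.2]
  have hS : (insert j D).card = n + 1 := by rw [card_insert_of_notMem hjD, hD'.2]
  have key : ∀ E ∈ J.powersetCard n, 0 < rawWeight J n x E → D.erase i ⊆ E ∨ E ⊆ insert j D := by
    intro E hE hwE
    by_contra! hcon
    obtain ⟨c, hc, hcE⟩ := not_subset.1 hcon.1
    obtain ⟨q, hq, hqS⟩ := not_subset.1 hcon.2
    have hE' := mem_powersetCard.1 hE
    exact rawWeight_eq_zero_of_swap hlt hE hq hcE (hD'.1 (mem_of_mem_erase hc))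
      (hlow q (mem_sdiff.2 ⟨hE'.1 hq, hqS⟩)) (hup c hc) hwE
  have mixed : ∀ E ∈ J.powersetCard n, ∀ F ∈ J.powersetCard n, 0 < rawWeight J n x E →
      0 < rawWeight J n x F → D.erase i ⊆ E → ¬ E ⊆ insert j D → F ⊆ insert j D →
      ¬ D.erase i ⊆ F → False := by
    intro E hE F hF hwE hwF h3 h4 h5 h6
    obtain ⟨q, hq, hqS⟩ := not_subset.1 h4
    obtain ⟨c, hc, hcF⟩ := not_subset.1 h6
    have hE' := mem_powersetCard.1 hE
    have hF' := mem_powersetCard.1 hF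
    have hcD := mem_of_mem_erase hc
    have hqD : q ∉ D := fun h => hqS (mem_insert_of_mem h)
    have hqC : q ∉ D.erase i := fun h => hqD (mem_of_mem_erase h)
    have hEe : insert q (D.erase i) = E := eq_of_subset_of_card_le
      (insert_subset hq h3) (by rw [card_insert_of_notMem hqC, hC, hE'.2]; omega)
    have hFe : F = insert j (D.erase c) := by
      refine eq_of_subset_of_card_le (fun k hk => ?_) ?_
      · rcases mem_insert.1 (h5 hk) with h | h
        · exact h ▸ mem_insert_self _ _
        · exact mem_insert_of_mem (mem_erase.2 ⟨fun h => hcF (h ▸ hk), h⟩)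
      · rw [card_insert_of_notMem (fun h => hjD (mem_of_mem_erase h)), card_erase_of_mem hcD,
          hD'.2, hF'.2]
        omega
    rw [rawWeight_pos_iff, ← hEe, coordSum_swap x hi hqD, halfGap] at hwE
    rw [rawWeight_pos_iff, hFe, coordSum_swap x hcD hjD, halfGap] at hwF
    have := hup c hc
    have := hlow q (mem_sdiff.2 ⟨hE'.1 hq, hqS⟩)
    linarith
  have hA' := mem_powersetCard.1 hA
  have hB' := mem_powersetCard.1 hB
  by_cases c1 : D.erase i ⊆ A <;> by_cases c2 : D.erase i ⊆ B
  · exact card_symmDiff_le_of_subset hC hA'.2 hB'.2 c1 c2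
  · have s2 := (key B hB hwB).resolve_left c2
    by_cases s1 : A ⊆ insert j D
    · exact card_symmDiff_le_of_superset hS hA'.2 hB'.2 s1 s2
    · exact (mixed A hA B hB hwA hwB c1 s1 s2 c2).elim
  · have s1 := (key A hA hwA).resolve_left c1
    by_cases s2 : B ⊆ insert j D
    · exact card_symmDiff_le_of_superset hS hA'.2 hB'.2 s1 s2
    · exact (mixed B hB A hA hwB hwA c2 s2 s1 c1).elim
  · exact card_symmDiff_le_of_superset hS hA'.2 hB'.2 ((key A hA hwA).resolve_left c1)
      ((key B hB hwB).resolve_left c2)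

/-- A family of `n`-sets at pairwise distance at most two shares `n - 1` elements, or is contained
in a set of `n + 1` elements. -/
lemma clique_cases {n : ℕ} (h1 : 1 < n) {J : Finset ℕ} {s : Finset (Finset ℕ)}
    (hs : s.Nonempty) (hJ : ∀ A ∈ s, A ⊆ J)
    (hcard : ∀ A ∈ s, A.card = n) (hd : ∀ A ∈ s, ∀ B ∈ s, (symmDiff A B).card ≤ 2) :
    (∃ C : Finset ℕ, C.card = n - 1 ∧ ∀ A ∈ s, C ⊆ A) ∨
      ∃ S ⊆ J, S.card = n + 1 ∧ ∀ A ∈ s, A ⊆ S := by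
  have hsd : ∀ A ∈ s, ∀ B ∈ s, (A \ B).card ≤ 1 := by
    intro A hA B hB
    have h := hd A hA B hB
    have e : symmDiff A B = (A \ B) ∪ (B \ A) := rfl
    rw [e, card_union_of_disjoint disjoint_sdiff_sdiff] at h
    have := card_sdiff_add_card_inter A B
    have := card_sdiff_add_card_inter B A
    rw [inter_comm] at this
    have := hcard A hA
    have := hcard B hB
    omega
  by_cases hsub : ∀ A ∈ s, ∀ B ∈ s, A = B
  · obtain ⟨A, hA⟩ := hs
    obtain ⟨i, hi⟩ := card_pos.1 (show 0 < A.card by rw [hcard A hA]; omega)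
    exact Or.inl ⟨A.erase i, by rw [card_erase_of_mem hi, hcard A hA],
      fun B hB => hsub A hA B hB ▸ erase_subset _ _⟩
  push Not at hsub
  obtain ⟨A, hA, B, hB, hne⟩ := hsub
  have cA := hcard A hA
  have cB := hcard B hB
  have hABne : (A \ B).card ≠ 0 := by
    intro h
    rw [card_eq_zero, sdiff_eq_empty_iff_subset] at h
    exact hne (eq_of_subset_of_card_le h (by omega))
  have hABcard : (A \ B).card = 1 := by have := hsd A hA B hB; omega
  have hBAcard : (B \ A).card = 1 := by
    have := card_sdiff_add_card_inter A B
    have := card_sdiff_add_card_inter B A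
    rw [inter_comm] at this
    omega
  have hinter : (A ∩ B).card = n - 1 := by
    have := card_sdiff_add_card_inter A B
    omega
  have hunion : (A ∪ B).card = n + 1 := by
    have := card_union_add_card_inter A B
    omega
  by_cases hN : ∀ D ∈ s, A ∩ B ⊆ D
  · exact Or.inl ⟨_, hinter, hN⟩
  by_cases hL : ∀ D ∈ s, D ⊆ A ∪ B
  · exact Or.inr ⟨_, union_subset (hJ A hA) (hJ B hB), hunion, hL⟩
  push Not at hN hL
  obtain ⟨D, hD, hDn⟩ := hN
  obtain ⟨E, hE, hEn⟩ := hL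
  obtain ⟨c, hc, hcD⟩ := not_subset.1 hDn
  obtain ⟨e, he, heU⟩ := not_subset.1 hEn
  rw [mem_inter] at hc
  rw [mem_union, not_or] at heU
  obtain ⟨i, hi⟩ := card_eq_one.1 hABcard
  obtain ⟨j, hj⟩ := card_eq_one.1 hBAcard
  have hi' : i ∈ A \ B := by simp [hi]
  have hj' : j ∈ B \ A := by simp [hj]
  rw [mem_sdiff] at hi' hj'
  have mem_of : ∀ X ∈ s, ∀ Y ∈ s, ∀ a b, a ∈ X → a ∉ Y → b ∈ X → b ≠ a → b ∈ Y := by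
    intro X hX Y hY a b ha haY hb hba
    by_contra hbY
    have h2 : ({a, b} : Finset ℕ) ⊆ X \ Y := by
      intro k hk
      rw [mem_insert, mem_singleton] at hk
      rcases hk with rfl | rfl <;> simp [*]
    have := card_le_card h2
    rw [card_pair hba.symm] at this
    have := hsd X hX Y hY
    omega
  have iD : i ∈ D := mem_of A hA D hD c i hc.1 hcD hi'.1 (fun h => hi'.2 (h ▸ hc.2))
  have jD : j ∈ D := mem_of B hB D hD c j hc.2 hcD hj'.1 (fun h => hj'.2 (h ▸ hc.1))
  have iE : i ∉ E := fun h => hi'.2 (mem_of E hE B hB e i he heU.2 h (fun h => heU.1 (h ▸ hi'.1)))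
  have jE : j ∉ E := fun h => hj'.2 (mem_of E hE A hA e j he heU.1 h (fun h => heU.2 (h ▸ hj'.1)))
  exact absurd (mem_of D hD E hE i j iD iE jD (fun h => hj'.2 (h ▸ hi'.1))) jE

end JohnsonVR

namespace JohnsonVR

lemma add_le_sum_of_ne {s : Finset ℕ} {y : ℕ → ℝ} (hy : ∀ k ∈ s, 0 ≤ y k) {a b : ℕ} (ha : a ∈ s)
    (hb : b ∈ s) (hab : a ≠ b) : y a + y b ≤ ∑ k ∈ s, y k := by
  rw [← sum_pair hab]
  refine sum_le_sum_of_subset_of_nonneg (fun k hk => ?_) fun k hk _ => hy k hk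
  rw [mem_insert, mem_singleton] at hk
  rcases hk with rfl | rfl <;> assumption

section facets

variable {J : Finset ℕ} {n : ℕ} {x : ℕ → ℝ}

lemma halfGap_le (h1 : 1 < n) (h2 : n + 1 < J.card) (h0 : ∀ k ∈ J, 0 ≤ x k)
    (hle : ∀ k ∈ J, x k ≤ 1) : halfGap J n x ≤ 1 / 2 := by
  obtain ⟨C, hC, hCx⟩ := exists_orderStat_le (J := J) (k := n - 1) (by omega) x
  obtain ⟨D, hD, hDx⟩ := exists_orderStat_le (J := J) (k := J.card - n - 1) (by omega) (-x)
  rw [mem_powersetCard] at hC hD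
  obtain ⟨c, hc⟩ := card_pos.1 (show 0 < C.card by omega)
  obtain ⟨d, hd⟩ := card_pos.1 (show 0 < D.card by omega)
  have h3 := hCx c hc
  have h4 := hDx d hd
  have h5 := hle c (hC.1 hc)
  have h6 := h0 d (hD.1 hd)
  simp only [Pi.neg_apply] at h4
  unfold halfGap upperLevel lowerLevel
  linarith

lemma mem_gapSet_of_lower {C : Finset ℕ} (h2 : n + 1 < J.card) (hn : 1 < n) (hCJ : C ⊆ J)
    (hC : C.card = n - 1) (h0 : ∀ k ∈ J, 0 ≤ x k) (hone : ∀ c ∈ C, x c = 1)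
    (hsum : ∑ k ∈ J \ C, x k = 1) : x ∈ gapSet J n := by
  have hcard : (J \ C).card = J.card - (n - 1) := by rw [card_sdiff_of_subset hCJ, hC]
  obtain ⟨i, hi, hmax⟩ := exists_max_image (J \ C) x (card_pos.1 (by omega))
  obtain ⟨j, hj⟩ := card_pos.1 (show 0 < ((J \ C).erase i).card by
    rw [card_erase_of_mem hi]; omega)
  rw [mem_erase] at hj
  have hi' := mem_sdiff.1 hi
  have hj' := mem_sdiff.1 hj.2
  have hjC : j ∉ insert i C := by simp [hj.1, hj'.2]
  refine ⟨C, insert j (insert i C), (subset_insert _ _).trans (subset_insert _ _),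
    insert_subset hj'.1 (insert_subset hi'.1 hCJ), hC, ?_, fun c hc q hq => ?_⟩
  · rw [card_insert_of_notMem hjC, card_insert_of_notMem hi'.2]; omega
  · simp only [mem_sdiff, mem_insert, not_or] at hq
    have hqC : q ∈ J \ C := mem_sdiff.2 ⟨hq.1, hq.2.2.2⟩
    have := add_le_sum_of_ne (fun k hk => h0 k (mem_sdiff.1 hk).1) hqC hi hq.2.2.1
    have := hmax q hqC
    have := hone c hc
    linarith

lemma mem_gapSet_of_upper {S : Finset ℕ} (hn : 1 < n) (hSJ : S ⊆ J)
    (hS : S.card = n + 1) (hle : ∀ k ∈ J, x k ≤ 1) (hzero : ∀ q ∈ J, q ∉ S → x q = 0)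
    (hsum : ∑ k ∈ S, (1 - x k) = 1) : x ∈ gapSet J n := by
  obtain ⟨i, hi, hmin⟩ := exists_min_image S x (card_pos.1 (by omega))
  obtain ⟨j, hj⟩ := card_pos.1 (show 0 < (S.erase i).card by
    rw [card_erase_of_mem hi]; omega)
  refine ⟨(S.erase i).erase j, S, (erase_subset _ _).trans (erase_subset _ _), hSJ, ?_, hS,
    fun c hc q hq => ?_⟩
  · rw [card_erase_of_mem hj, card_erase_of_mem hi]; omega
  · rw [mem_sdiff] at hq
    simp only [mem_erase] at hc
    have := add_le_sum_of_ne (y := fun k => 1 - x k)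
      (fun k hk => sub_nonneg.2 (hle k (hSJ hk))) hc.2.2 hi hc.2.1
    have := hmin c hc.2.2
    have := hzero q hq.1 hq.2
    linarith

lemma subset_of_rawWeight_pos_of_lower {A C : Finset ℕ} (h1 : 1 < n) (h2 : n + 1 < J.card)
    (hCJ : C ⊆ J)
    (hC : C.card = n - 1) (h0 : ∀ k ∈ J, 0 ≤ x k) (hle : ∀ k ∈ J, x k ≤ 1)
    (hone : ∀ c ∈ C, x c = 1)
    (hsum : ∑ k ∈ J \ C, x k = 1) (hA : A ∈ J.powersetCard n) (hw : 0 < rawWeight J n x A) :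
    C ⊆ A := by
  by_contra hcon
  obtain ⟨c, hc, hcA⟩ := not_subset.1 hcon
  have hA' := mem_powersetCard.1 hA
  have hcard : 1 < (A \ C).card := by
    have e1 := card_sdiff_add_card_inter A C
    have : A ∩ C ⊆ C.erase c := fun k hk => by
      rw [mem_inter] at hk
      exact mem_erase.2 ⟨fun h => hcA (h ▸ hk.1), hk.2⟩
    have := card_le_card this
    rw [card_erase_of_mem hc] at this
    omega
  obtain ⟨a, ha, b, hb, hab⟩ := one_lt_card.1 hcard
  have hhalf := halfGap_le h1 h2 h0 hle
  rw [rawWeight_pos_iff] at hw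
  have big : ∀ q ∈ A \ C, 1 / 2 < x q := by
    intro q hq
    rw [mem_sdiff] at hq
    have := coordSum_le_maxSum (swap_mem_powersetCard hA hq.1 hcA (hCJ hc)) x
    rw [coordSum_swap x hq.1 hcA, hone c hc] at this
    linarith
  have hsub : A \ C ⊆ J \ C := sdiff_subset_sdiff hA'.1 le_rfl
  have := add_le_sum_of_ne (fun k hk => h0 k (mem_sdiff.1 hk).1) (hsub ha) (hsub hb) hab
  have := big a ha
  have := big b hb
  linarith

lemma subset_of_rawWeight_pos_of_upper {A S : Finset ℕ} (h1 : 1 < n) (h2 : n + 1 < J.card)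
    (hSJ : S ⊆ J)
    (hS : S.card = n + 1) (h0 : ∀ k ∈ J, 0 ≤ x k) (hle : ∀ k ∈ J, x k ≤ 1)
    (hzero : ∀ q ∈ J, q ∉ S → x q = 0)
    (hsum : ∑ k ∈ S, (1 - x k) = 1) (hA : A ∈ J.powersetCard n) (hw : 0 < rawWeight J n x A) :
    A ⊆ S := by
  by_contra hcon
  obtain ⟨q, hq, hqS⟩ := not_subset.1 hcon
  have hA' := mem_powersetCard.1 hA
  have hcard : 1 < (S \ A).card := by
    have e1 := card_sdiff_add_card_inter S A
    have : S ∩ A ⊆ A.erase q := fun k hk => by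
      rw [mem_inter] at hk
      exact mem_erase.2 ⟨fun h => hqS (h ▸ hk.1), hk.2⟩
    have := card_le_card this
    rw [card_erase_of_mem hq] at this
    omega
  obtain ⟨a, ha, b, hb, hab⟩ := one_lt_card.1 hcard
  have hhalf := halfGap_le h1 h2 h0 hle
  rw [rawWeight_pos_iff] at hw
  have small : ∀ c ∈ S \ A, x c < 1 / 2 := by
    intro c hc
    rw [mem_sdiff] at hc
    have := coordSum_le_maxSum (swap_mem_powersetCard hA hq hc.2 (hSJ hc.1)) x
    rw [coordSum_swap x hq hc.2, hzero q (hA'.1 hq) hqS] at this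
    linarith
  have := add_le_sum_of_ne (y := fun k => 1 - x k) (fun k hk => sub_nonneg.2 (hle k (hSJ hk)))
    (mem_sdiff.1 ha).1 (mem_sdiff.1 hb).1 hab
  have := small a ha
  have := small b hb
  linarith

end facets

noncomputable section

/-- The affine map sending the vertex `A` to its indicator function. -/
def toCoord (J : Finset ℕ) (n : ℕ) (p : Finset ℕ → ℝ) : ℕ → ℝ :=
  fun k => ∑ A ∈ J.powersetCard n, if k ∈ A then p A else 0

lemma continuous_toCoord (J : Finset ℕ) (n : ℕ) : Continuous (toCoord J n) := by
  refine continuous_pi fun k => continuous_finsetSum _ fun A _ => ?_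
  split_ifs
  · exact continuous_apply A
  · exact continuous_const

end

lemma mem_VRc_faces {m n : ℕ} {s : Finset (Finset ℕ)} : s ∈ (VRc (Fnm m n) 2).faces ↔
    s.Nonempty ∧ s ⊆ (Icc 1 m).powersetCard n ∧ ∀ A ∈ s, ∀ B ∈ s, (symmDiff A B).card ≤ 2 := by
  have : s ⊆ (Icc 1 m).powersetCard n ↔ ∀ A ∈ s, A ∈ Fnm m n := by
    simp only [Fnm, subset_iff, mem_powersetCard, Set.mem_ofPred_eq]
  rw [this]
  rfl

lemma toCoord_eq_sum {J : Finset ℕ} {n : ℕ} {s : Finset (Finset ℕ)} {p : Finset ℕ → ℝ}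
    (hs : s ⊆ J.powersetCard n) (hp : ∀ A, p A ≠ 0 → A ∈ s) (k : ℕ) :
    toCoord J n p k = ∑ A ∈ s, if k ∈ A then p A else 0 := by
  refine (sum_subset hs fun A _ hA => ?_).symm
  have : p A = 0 := by_contra fun h => hA (hp A h)
  simp [this]

lemma toCoord_facets {J : Finset ℕ} {n : ℕ} (h1 : 1 < n) (h2 : n + 1 < J.card)
    {s : Finset (Finset ℕ)} (hs : s.Nonempty) (hsJ : s ⊆ J.powersetCard n)
    (hd : ∀ A ∈ s, ∀ B ∈ s, (symmDiff A B).card ≤ 2) {p : Finset ℕ → ℝ} (h0 : ∀ A, 0 ≤ p A)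
    (hp : ∀ A, p A ≠ 0 → A ∈ s) (hsum : ∑ A ∈ s, p A = 1) :
    toCoord J n p ∈ gapSet J n ∧ ∀ A ∈ J.powersetCard n, 0 < rawWeight J n (toCoord J n p) A →
      ∀ B ∈ s, (symmDiff A B).card ≤ 2 := by
  have hsJ' : ∀ A ∈ s, A ⊆ J ∧ A.card = n := fun A hA => mem_powersetCard.1 (hsJ hA)
  have e := toCoord_eq_sum hsJ hp
  have hx0 : ∀ k ∈ J, 0 ≤ toCoord J n p k := fun k _ => by
    rw [e]; exact sum_nonneg fun A _ => by split_ifs <;> simp [h0]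
  have hx1 : ∀ k ∈ J, toCoord J n p k ≤ 1 := fun k _ => by
    rw [e, ← hsum]; exact sum_le_sum fun A _ => by split_ifs <;> simp [h0]
  have htot : ∑ k ∈ J, toCoord J n p k = n := by
    simp_rw [e]
    rw [sum_comm]
    have : ∀ A ∈ s, (∑ k ∈ J, if k ∈ A then p A else 0) = p A * n := by
      intro A hA
      rw [← sum_filter, filter_mem_eq_inter, inter_eq_right.2 (hsJ' A hA).1, sum_const,
        (hsJ' A hA).2, nsmul_eq_mul, mul_comm]
    rw [sum_congr rfl this, ← sum_mul, hsum, one_mul]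
  rcases clique_cases h1 hs (fun A hA => (hsJ' A hA).1) (fun A hA => (hsJ' A hA).2) hd with
    ⟨C, hC, hCs⟩ | ⟨S, hSJ, hS, hSs⟩
  · have hCJ : C ⊆ J := by
      obtain ⟨A, hA⟩ := hs
      exact (hCs A hA).trans (hsJ' A hA).1
    have hone : ∀ c ∈ C, toCoord J n p c = 1 := fun c hc => by
      rw [e, ← hsum]
      exact sum_congr rfl fun A hA => if_pos (hCs A hA hc)
    have hs1 : ∑ k ∈ J \ C, toCoord J n p k = 1 := by
      have := sum_sdiff (f := toCoord J n p) hCJ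
      rw [htot, sum_congr rfl hone, sum_const, hC, nsmul_eq_mul, mul_one,
        Nat.cast_sub h1.le] at this
      push_cast at this
      linarith
    refine ⟨mem_gapSet_of_lower h2 h1 hCJ hC hx0 hone hs1, fun A hA hw B hB => ?_⟩
    exact card_symmDiff_le_of_subset hC (mem_powersetCard.1 hA).2 (hsJ' B hB).2
      (subset_of_rawWeight_pos_of_lower h1 h2 hCJ hC hx0 hx1 hone hs1 hA hw) (hCs B hB)
  · have hzero : ∀ q ∈ J, q ∉ S → toCoord J n p q = 0 := fun q _ hq => by
      rw [e]
      exact sum_eq_zero fun A hA => if_neg fun h => hq (hSs A hA h)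
    have hs1 : ∑ k ∈ S, (1 - toCoord J n p k) = 1 := by
      have h3 := sum_sdiff (f := toCoord J n p) hSJ
      rw [htot, sum_eq_zero fun q hq => hzero q (mem_sdiff.1 hq).1 (mem_sdiff.1 hq).2] at h3
      rw [sum_sub_distrib, sum_const, hS, nsmul_eq_mul, mul_one]
      push_cast
      linarith
    refine ⟨mem_gapSet_of_upper h1 hSJ hS hx1 hzero hs1, fun A hA hw B hB => ?_⟩
    exact card_symmDiff_le_of_superset hS (mem_powersetCard.1 hA).2 (hsJ' B hB).2
      (subset_of_rawWeight_pos_of_upper h1 h2 hSJ hS hx0 hx1 hzero hs1 hA hw) (hSs B hB)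

end JohnsonVR

namespace JohnsonVR

lemma nonempty_homotopyEquiv_of_segment_subset {E F : Type*} [AddCommGroup E] [Module ℝ E]
    [TopologicalSpace E] [ContinuousAdd E] [ContinuousSMul ℝ E] [AddCommGroup F] [Module ℝ F]
    [TopologicalSpace F] [ContinuousAdd F] [ContinuousSMul ℝ F] {S : Set E} {T : Set F}
    (f : C(S, T)) (g : C(T, S)) (hS : ∀ x : S, segment ℝ (g (f x) : E) x ⊆ S)
    (hT : ∀ y : T, segment ℝ (f (g y) : F) y ⊆ T) :
    Nonempty (ContinuousMap.HomotopyEquiv S T) := by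
  refine ⟨⟨f, g, ⟨?_⟩, ⟨?_⟩⟩⟩
  · refine ⟨⟨fun p => ⟨(1 - (p.1 : ℝ)) • (g (f p.2) : E) + (p.1 : ℝ) • (p.2 : E),
      hS p.2 ⟨1 - p.1, p.1, by simpa using p.1.2.2, p.1.2.1, by ring, rfl⟩⟩, ?_⟩, ?_, ?_⟩
    · fun_prop
    · intro x; ext; simp
    · intro x; ext; simp
  · refine ⟨⟨fun p => ⟨(1 - (p.1 : ℝ)) • (f (g p.2) : F) + (p.1 : ℝ) • (p.2 : F),
      hT p.2 ⟨1 - p.1, p.1, by simpa using p.1.2.2, p.1.2.1, by ring, rfl⟩⟩, ?_⟩, ?_, ?_⟩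
    · fun_prop
    · intro x; ext; simp
    · intro x; ext; simp

noncomputable section

/-- The raw weights normalised to sum to one. -/
def weight (J : Finset ℕ) (n : ℕ) (x : ℕ → ℝ) (A : Finset ℕ) : ℝ :=
  if A ∈ J.powersetCard n then
    rawWeight J n x A / ∑ B ∈ J.powersetCard n, rawWeight J n x B else 0

/-- The sets of positive raw weight. -/
def heavy (J : Finset ℕ) (n : ℕ) (x : ℕ → ℝ) : Finset (Finset ℕ) :=
  {A ∈ J.powersetCard n | 0 < rawWeight J n x A}

end

variable {J : Finset ℕ} {n : ℕ} {x : ℕ → ℝ}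

lemma heavy_nonempty (h1 : 1 < n) (h2 : n + 1 < J.card) (hx : x ∈ gapSet J n) :
    (heavy J n x).Nonempty := by
  obtain ⟨A, hA, -, -, -, -, -, e, -⟩ := exists_sorted h1 h2 x
  refine ⟨A, mem_filter.2 ⟨hA, rawWeight_pos_iff.2 ?_⟩⟩
  have := lowerLevel_lt_upperLevel h1 h2 hx
  rw [e, halfGap]
  linarith

lemma sum_rawWeight_pos (h1 : 1 < n) (h2 : n + 1 < J.card) (hx : x ∈ gapSet J n) :
    0 < ∑ B ∈ J.powersetCard n, rawWeight J n x B := by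
  obtain ⟨A, hA⟩ := heavy_nonempty h1 h2 hx
  rw [heavy, mem_filter] at hA
  exact sum_pos' (fun B _ => rawWeight_nonneg J n x B) ⟨A, hA⟩

lemma weight_nonneg (J : Finset ℕ) (n : ℕ) (x : ℕ → ℝ) (A : Finset ℕ) : 0 ≤ weight J n x A := by
  unfold weight
  split_ifs
  · exact div_nonneg (rawWeight_nonneg ..) (sum_nonneg fun B _ => rawWeight_nonneg ..)
  · rfl

lemma mem_heavy_of_weight_ne_zero {A : Finset ℕ} (h : weight J n x A ≠ 0) : A ∈ heavy J n x := by
  unfold weight at h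
  split_ifs at h with hA
  · refine mem_filter.2 ⟨hA, (rawWeight_nonneg ..).lt_of_ne fun h0 => h ?_⟩
    rw [← h0, zero_div]
  · exact absurd rfl h

lemma sum_weight {s : Finset (Finset ℕ)} (h1 : 1 < n) (h2 : n + 1 < J.card) (hx : x ∈ gapSet J n)
    (hs : heavy J n x ⊆ s) : ∑ A ∈ s, weight J n x A = 1 := by
  have e : ∑ A ∈ J.powersetCard n, weight J n x A = 1 := by
    rw [← div_self (sum_rawWeight_pos h1 h2 hx).ne', sum_div]
    exact sum_congr rfl fun A hA => if_pos hA
  rw [← e]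
  have h := sum_subset hs fun A _ hA =>
    by_contra fun h => hA (mem_heavy_of_weight_ne_zero (J := J) (n := n) (x := x) h)
  rw [← h]
  exact sum_subset (filter_subset _ _) fun A _ hA =>
    by_contra fun h => hA (mem_heavy_of_weight_ne_zero (J := J) (n := n) (x := x) h)

lemma continuous_weight (h1 : 1 < n) (h2 : n + 1 < J.card) :
    Continuous fun x : gapSet J n => weight J n x := by
  refine continuous_pi fun A => ?_
  unfold weight
  by_cases hA : A ∈ J.powersetCard n
  · simp only [hA, if_true]
    refine Continuous.div ((continuous_rawWeight J n A).comp continuous_subtype_val)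
      (continuous_finsetSum _ fun B _ => (continuous_rawWeight J n B).comp continuous_subtype_val)
      fun x => (sum_rawWeight_pos h1 h2 x.2).ne'
  · simp only [hA, if_false]
    exact continuous_const

lemma toCoord_weight_mem_cone {A : Finset ℕ} {i j : ℕ} (h1 : 1 < n) (h2 : n + 1 < J.card)
    (hx : x ∈ gapSet J n) (hA : A ∈ J.powersetCard n)
    (hm : maxSum J n x = coordSum x A)
    (hu : ∀ c ∈ A.erase i, upperLevel J n x ≤ x c)
    (hl : ∀ q ∈ J \ insert j A, x q ≤ lowerLevel J n x) :
    toCoord J n (weight J n x) ∈ cone J (A.erase i) (insert j A) := by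
  have hlt := lowerLevel_lt_upperLevel h1 h2 hx
  have hAw : 0 < rawWeight J n x A := rawWeight_pos_iff.2 (by rw [hm, halfGap]; linarith)
  have hS := sum_rawWeight_pos h1 h2 hx
  intro c hc q hq
  have hqA : q ∉ A := fun h => (mem_sdiff.1 hq).2 (mem_insert_of_mem h)
  have hcA := mem_of_mem_erase hc
  have hle : ∀ B ∈ J.powersetCard n, (if q ∈ B then weight J n x B else 0) ≤
      (if c ∈ B then weight J n x B else 0) := by
    intro B hB
    by_cases hqB : q ∈ B
    · by_cases hcB : c ∈ B
      · simp [hqB, hcB]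
      · have := rawWeight_eq_zero_of_swap hlt hB hqB hcB ((mem_powersetCard.1 hA).1 hcA)
          (hl q hq) (hu c hc)
        have h0 : weight J n x B = 0 := by_contra fun h =>
          this (mem_filter.1 (mem_heavy_of_weight_ne_zero h)).2
        simp [h0]
    · rw [if_neg hqB]
      split_ifs
      exacts [weight_nonneg .., le_rfl]
  refine sum_lt_sum hle ⟨A, hA, ?_⟩
  rw [if_neg hqA, if_pos hcA, weight, if_pos hA]
  positivity

lemma segment_subset_gapSet (h1 : 1 < n) (h2 : n + 1 < J.card) (hx : x ∈ gapSet J n) :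
    segment ℝ (toCoord J n (weight J n x)) x ⊆ gapSet J n := by
  obtain ⟨A, hA, i, hi, j, hjJ, hj, hm, -, hu, hl⟩ := exists_sorted h1 h2 x
  have hlt := lowerLevel_lt_upperLevel h1 h2 hx
  have hA' := mem_powersetCard.1 hA
  have hxc : x ∈ cone J (A.erase i) (insert j A) := fun c hc q hq =>
    (hl q hq).trans_lt (hlt.trans_le (hu c hc))
  intro y hy
  refine ⟨A.erase i, insert j A, (erase_subset _ _).trans (subset_insert _ _),
    insert_subset hjJ hA'.1, by rw [card_erase_of_mem hi, hA'.2],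
    by rw [card_insert_of_notMem hj, hA'.2],
    (convex_cone J _ _).segment_subset (toCoord_weight_mem_cone h1 h2 hx hA hm hu hl) hxc hy⟩

lemma nonempty_homotopyEquiv_gapSet {m n : ℕ} (h1 : 1 < n) (h2 : n + 1 < m) :
    Nonempty (ContinuousMap.HomotopyEquiv (VRc (Fnm m n) 2).space (gapSet (Icc 1 m) n)) := by
  have h2' : n + 1 < (Icc 1 m).card := by simpa using h2
  have hf : ∀ p ∈ {p : Finset ℕ → ℝ | (∀ v, 0 ≤ p v) ∧ ∃ s ∈ (VRc (Fnm m n) 2).faces,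
      (∀ v, p v ≠ 0 → v ∈ s) ∧ ∑ v ∈ s, p v = 1}, toCoord (Icc 1 m) n p ∈ gapSet (Icc 1 m) n := by
    rintro p ⟨h0, s, hs, hp, hsum⟩
    obtain ⟨hne, hsJ, hd⟩ := mem_VRc_faces.1 hs
    exact (toCoord_facets h1 h2' hne hsJ hd h0 hp hsum).1
  let f : C({p : Finset ℕ → ℝ | (∀ v, 0 ≤ p v) ∧ ∃ s ∈ (VRc (Fnm m n) 2).faces,
      (∀ v, p v ≠ 0 → v ∈ s) ∧ ∑ v ∈ s, p v = 1}, gapSet (Icc 1 m) n) :=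
    ⟨fun p => ⟨toCoord (Icc 1 m) n p, hf p p.2⟩,
      ((continuous_toCoord _ n).comp continuous_subtype_val).subtype_mk _⟩
  let g : C(gapSet (Icc 1 m) n, {p : Finset ℕ → ℝ | (∀ v, 0 ≤ p v) ∧
      ∃ s ∈ (VRc (Fnm m n) 2).faces, (∀ v, p v ≠ 0 → v ∈ s) ∧ ∑ v ∈ s, p v = 1}) :=
    ⟨fun x => ⟨weight (Icc 1 m) n x, weight_nonneg _ _ _, heavy (Icc 1 m) n x,
      mem_VRc_faces.2 ⟨heavy_nonempty h1 h2' x.2, filter_subset _ _, fun A hA B hB =>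
        card_symmDiff_le_of_rawWeight_pos h1 h2' x.2 (mem_filter.1 hA).1 (mem_filter.1 hB).1
          (mem_filter.1 hA).2 (mem_filter.1 hB).2⟩,
      fun A => mem_heavy_of_weight_ne_zero, sum_weight h1 h2' x.2 subset_rfl⟩,
      (continuous_weight h1 h2').subtype_mk _⟩
  refine nonempty_homotopyEquiv_of_segment_subset f g ?_ ?_
  · rintro ⟨p, h0, s, hs, hp, hsum⟩ _ ⟨a, b, ha, hb, hab, rfl⟩
    obtain ⟨hne, hsJ, hd⟩ := mem_VRc_faces.1 hs
    obtain ⟨hx, hH⟩ := toCoord_facets h1 h2' hne hsJ hd h0 hp hsum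
    set x := toCoord (Icc 1 m) n p
    have hHs : ∀ A ∈ heavy (Icc 1 m) n x, ∀ B ∈ s, (symmDiff A B).card ≤ 2 := fun A hA B hB =>
      hH A (mem_filter.1 hA).1 (mem_filter.1 hA).2 B hB
    refine ⟨fun A => add_nonneg (mul_nonneg ha (weight_nonneg _ _ x A)) (mul_nonneg hb (h0 A)),
      heavy (Icc 1 m) n x ∪ s, mem_VRc_faces.2 ⟨hne.inr, union_subset (filter_subset _ _) hsJ, ?_⟩,
      fun A hA => ?_, ?_⟩
    · intro A hA B hB
      rcases mem_union.1 hA with hA | hA <;> rcases mem_union.1 hB with hB | hB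
      · exact card_symmDiff_le_of_rawWeight_pos h1 h2' hx (mem_filter.1 hA).1 (mem_filter.1 hB).1
          (mem_filter.1 hA).2 (mem_filter.1 hB).2
      · exact hHs A hA B hB
      · rw [symmDiff_comm]; exact hHs B hB A hA
      · exact hd A hA B hB
    · by_contra hcon
      rw [mem_union, not_or] at hcon
      refine hA ?_
      have e1 : weight (Icc 1 m) n x A = 0 := by_contra fun h =>
        hcon.1 (mem_heavy_of_weight_ne_zero h)
      have e2 : p A = 0 := by_contra fun h => hcon.2 (hp A h)
      change a * weight (Icc 1 m) n x A + b * p A = 0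
      rw [e1, e2]; ring
    · change ∑ A ∈ heavy (Icc 1 m) n x ∪ s, (a * weight (Icc 1 m) n x A + b * p A) = 1
      rw [sum_add_distrib, ← mul_sum, ← mul_sum, sum_weight h1 h2' hx subset_union_left,
        ← sum_subset (f := p) subset_union_right fun A _ hA => by_contra fun h => hA (hp A h),
        hsum, mul_one, mul_one, hab]
  · exact fun x => segment_subset_gapSet h1 h2' x.2

end JohnsonVR

namespace JohnsonVR

/-- The part of the `d`-skeleton of the cube `[0,1]^m` spanned by the points whose number of
nonzero coordinates is at most `n` and whose number of unit coordinates is at least `n - d`. -/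
def cubeSlab (d m n : ℕ) : Set (Fin m → ℝ) :=
  {y | (∀ i, 0 ≤ y i ∧ y i ≤ 1) ∧ #{i | y i ≠ 0} ≤ n ∧ n ≤ #{i | y i = 1} + d}

noncomputable section

/-- The coordinates of `x` rescaled so that the lower level becomes `0` and the upper level `1`. -/
def rescale (m n : ℕ) (x : ℕ → ℝ) (i : Fin m) : ℝ :=
  max 0 (min 1 ((x (i + 1) - lowerLevel (Icc 1 m) n x) /
    (upperLevel (Icc 1 m) n x - lowerLevel (Icc 1 m) n x)))

/-- Extension by zero, with the coordinates renumbered from `1` to `m`. -/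
def extendZero (m : ℕ) (y : Fin m → ℝ) (k : ℕ) : ℝ :=
  if h : 1 ≤ k ∧ k ≤ m then y ⟨k - 1, by omega⟩ else 0

end

variable {m n : ℕ}

@[simp] lemma extendZero_succ (y : Fin m → ℝ) (i : Fin m) : extendZero m y (i + 1) = y i := by
  have : 1 ≤ (i : ℕ) + 1 ∧ (i : ℕ) + 1 ≤ m := ⟨by omega, i.2⟩
  simp [extendZero, this]

lemma exists_eq_succ {k : ℕ} (hk : k ∈ Icc 1 m) : ∃ i : Fin m, k = i + 1 := by
  rw [mem_Icc] at hk
  exact ⟨⟨k - 1, by omega⟩, by simp; omega⟩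

lemma succ_mem_Icc (i : Fin m) : (i : ℕ) + 1 ∈ Icc 1 m := mem_Icc.2 ⟨by omega, i.2⟩

lemma continuous_extendZero (m : ℕ) : Continuous (extendZero m) := by
  refine continuous_pi fun k => ?_
  unfold extendZero
  split_ifs
  exacts [continuous_apply _, continuous_const]

lemma continuous_rescale (h1 : 1 < n) (h2 : n + 1 < (Icc 1 m).card) :
    Continuous fun x : gapSet (Icc 1 m) n => rescale m n x := by
  refine continuous_pi fun i => ?_
  unfold rescale
  have hu := (continuous_upperLevel (Icc 1 m) n).comp
    (continuous_subtype_val (p := fun x => x ∈ gapSet (Icc 1 m) n))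
  have hl := (continuous_lowerLevel (Icc 1 m) n).comp
    (continuous_subtype_val (p := fun x => x ∈ gapSet (Icc 1 m) n))
  refine continuous_const.max (continuous_const.min (Continuous.div ?_ (hu.sub hl) fun x =>
    (sub_pos.2 (lowerLevel_lt_upperLevel h1 h2 x.2)).ne'))
  exact ((continuous_apply _).comp continuous_subtype_val).sub hl

lemma rescale_eq_one {x : ℕ → ℝ} {i : Fin m}
    (h : lowerLevel (Icc 1 m) n x < upperLevel (Icc 1 m) n x)
    (hi : upperLevel (Icc 1 m) n x ≤ x (i + 1)) : rescale m n x i = 1 := by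
  rw [rescale, min_eq_left, max_eq_right zero_le_one]
  rw [one_le_div (by linarith)]
  linarith

lemma rescale_eq_zero {x : ℕ → ℝ} {i : Fin m}
    (h : lowerLevel (Icc 1 m) n x < upperLevel (Icc 1 m) n x)
    (hi : x (i + 1) ≤ lowerLevel (Icc 1 m) n x) : rescale m n x i = 0 := by
  refine max_eq_left ((min_le_right _ _).trans (div_nonpos_of_nonpos_of_nonneg ?_ ?_)) <;> linarith

lemma rescale_mem_cubeSlab (h1 : 1 < n) (h2 : n + 1 < (Icc 1 m).card) {x : ℕ → ℝ}
    (hx : x ∈ gapSet (Icc 1 m) n) : rescale m n x ∈ cubeSlab 2 m (n + 1) := by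
  obtain ⟨A, hA, i, hi, j, hjJ, hj, -, -, hu, hl⟩ := exists_sorted h1 h2 x
  have hlt := lowerLevel_lt_upperLevel h1 h2 hx
  rw [mem_powersetCard] at hA
  refine ⟨fun k => ⟨le_max_left _ _, max_le zero_le_one (min_le_left _ _)⟩, ?_, ?_⟩
  · have hS : (insert j A).card = n + 1 := by rw [card_insert_of_notMem hj, hA.2]
    rw [← hS]
    refine card_le_card_of_injOn (fun k => (k : ℕ) + 1) (fun k hk => ?_)
      (fun a _ b _ h => by simpa [Fin.ext_iff] using h)
    by_contra hcon
    exact (mem_filter.1 hk).2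
      (rescale_eq_zero hlt (hl _ (mem_sdiff.2 ⟨succ_mem_Icc k, hcon⟩)))
  · have hC : (A.erase i).card = n - 1 := by rw [card_erase_of_mem hi, hA.2]
    have : A.erase i ⊆ ({k | rescale m n x k = 1} : Finset (Fin m)).image (fun k : Fin m => (k : ℕ) + 1) := by
      intro c hc
      obtain ⟨k, rfl⟩ := exists_eq_succ (hA.1 (mem_of_mem_erase hc))
      exact mem_image.2 ⟨k, mem_filter.2 ⟨mem_univ _, rescale_eq_one hlt (hu _ hc)⟩, rfl⟩
    have := (card_le_card this).trans card_image_le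
    omega

lemma exists_flag_of_mem_cubeSlab (h1 : 1 < n) (h2 : n + 1 < (Icc 1 m).card) {y : Fin m → ℝ}
    (hy : y ∈ cubeSlab 2 m (n + 1)) : ∃ C S : Finset ℕ, C ⊆ S ∧ S ⊆ Icc 1 m ∧ C.card = n - 1 ∧
      S.card = n + 1 ∧ (∀ c ∈ C, extendZero m y c = 1) ∧
      ∀ q ∈ Icc 1 m \ S, extendZero m y q = 0 := by
  obtain ⟨-, hz, ho⟩ := hy
  have hinj : Function.Injective fun k : Fin m => (k : ℕ) + 1 := fun a b h => by
    simpa [Fin.ext_iff] using h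
  obtain ⟨C, hC, hCc⟩ := exists_subset_card_eq (n := n - 1)
    (s := ({k | y k = 1} : Finset (Fin m)).image fun k : Fin m => (k : ℕ) + 1)
    (by rw [card_image_of_injective _ hinj]; omega)
  obtain ⟨S, hS, hSJ, hSc⟩ := exists_subsuperset_card_eq (n := n + 1)
    (s := ({k | y k ≠ 0} : Finset (Fin m)).image fun k : Fin m => (k : ℕ) + 1) (t := Icc 1 m)
    (image_subset_iff.2 fun k _ => succ_mem_Icc k)
    (by rw [card_image_of_injective _ hinj]; omega) h2.le
  refine ⟨C, S, fun c hc => hS ?_, hSJ, hCc, hSc, fun c hc => ?_, fun q hq => ?_⟩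
  · obtain ⟨k, hk, rfl⟩ := mem_image.1 (hC hc)
    refine mem_image_of_mem _ (mem_filter.2 ⟨mem_univ _, ?_⟩)
    rw [(mem_filter.1 hk).2]
    exact one_ne_zero
  · obtain ⟨k, hk, rfl⟩ := mem_image.1 (hC hc)
    rw [extendZero_succ, (mem_filter.1 hk).2]
  · obtain ⟨k, rfl⟩ := exists_eq_succ (mem_sdiff.1 hq).1
    rw [extendZero_succ]
    by_contra h
    exact (mem_sdiff.1 hq).2 (hS (mem_image_of_mem _ (mem_filter.2 ⟨mem_univ _, h⟩)))

lemma levels_extendZero (h1 : 1 < n) (h2 : n + 1 < (Icc 1 m).card) {y : Fin m → ℝ}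
    (hy : y ∈ cubeSlab 2 m (n + 1)) : upperLevel (Icc 1 m) n (extendZero m y) = 1 ∧
      lowerLevel (Icc 1 m) n (extendZero m y) = 0 := by
  obtain ⟨C, S, hCS, hSJ, hC, hS, hone, hzero⟩ := exists_flag_of_mem_cubeSlab h1 h2 hy
  have hb : ∀ k ∈ Icc 1 m, 0 ≤ extendZero m y k ∧ extendZero m y k ≤ 1 := fun k hk => by
    obtain ⟨i, rfl⟩ := exists_eq_succ hk
    simpa using hy.1 i
  have hcard : (Icc 1 m \ S).card = (Icc 1 m).card - n - 1 := by
    rw [card_sdiff_of_subset hSJ, hS]; omega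
  constructor
  · refine le_antisymm ?_ ?_
    · obtain ⟨D, hD, h⟩ := exists_orderStat_le (k := n - 1) (J := Icc 1 m) (by omega)
        (extendZero m y)
      rw [mem_powersetCard] at hD
      obtain ⟨c, hc⟩ := card_pos.1 (show 0 < D.card by omega)
      exact (h c hc).trans (hb c (hD.1 hc)).2
    · obtain ⟨c, hc, h⟩ := exists_le_orderStat (k := n - 1) (J := Icc 1 m) (by omega)
        (mem_powersetCard.2 ⟨hCS.trans hSJ, hC⟩) (extendZero m y)
      rwa [hone c hc] at h
  · refine le_antisymm ?_ ?_
    · obtain ⟨q, hq, h⟩ := exists_le_orderStat (k := (Icc 1 m).card - n - 1) (J := Icc 1 m)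
        (by omega) (mem_powersetCard.2 ⟨sdiff_subset, hcard⟩) (-extendZero m y)
      rw [Pi.neg_apply, hzero q hq] at h
      rw [lowerLevel]
      linarith
    · obtain ⟨D, hD, h⟩ := exists_orderStat_le (k := (Icc 1 m).card - n - 1) (J := Icc 1 m)
        (by omega) (-extendZero m y)
      rw [mem_powersetCard] at hD
      obtain ⟨q, hq⟩ := card_pos.1 (show 0 < D.card by omega)
      have := h q hq
      have := (hb q (hD.1 hq)).1
      rw [Pi.neg_apply] at *
      rw [lowerLevel]
      linarith

lemma nonempty_homotopyEquiv_cubeSlab (h1 : 1 < n) (h2 : n + 1 < m) :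
    Nonempty (ContinuousMap.HomotopyEquiv (gapSet (Icc 1 m) n) (cubeSlab 2 m (n + 1))) := by
  have h2' : n + 1 < (Icc 1 m).card := by simpa using h2
  have hg : ∀ y ∈ cubeSlab 2 m (n + 1), extendZero m y ∈ gapSet (Icc 1 m) n := fun y hy => by
    obtain ⟨C, S, hCS, hSJ, hC, hS, hone, hzero⟩ := exists_flag_of_mem_cubeSlab h1 h2' hy
    refine ⟨C, S, hCS, hSJ, hC, hS, fun c hc q hq => ?_⟩
    rw [hone c hc, hzero q hq]
    exact one_pos
  let f : C(gapSet (Icc 1 m) n, cubeSlab 2 m (n + 1)) :=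
    ⟨fun x => ⟨rescale m n x, rescale_mem_cubeSlab h1 h2' x.2⟩,
      (continuous_rescale h1 h2').subtype_mk _⟩
  let g : C(cubeSlab 2 m (n + 1), gapSet (Icc 1 m) n) :=
    ⟨fun y => ⟨extendZero m y, hg y y.2⟩,
      ((continuous_extendZero m).comp continuous_subtype_val).subtype_mk _⟩
  refine nonempty_homotopyEquiv_of_segment_subset f g (fun x => ?_) (fun y => ?_)
  · obtain ⟨x, hx⟩ := x
    obtain ⟨A, hA, i, hi, j, hjJ, hj, -, -, hu, hl⟩ := exists_sorted h1 h2' x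
    have hlt := lowerLevel_lt_upperLevel h1 h2' hx
    rw [mem_powersetCard] at hA
    have hxc : x ∈ cone (Icc 1 m) (A.erase i) (insert j A) := fun c hc q hq =>
      (hl q hq).trans_lt (hlt.trans_le (hu c hc))
    have hyc : extendZero m (rescale m n x) ∈ cone (Icc 1 m) (A.erase i) (insert j A) := by
      intro c hc q hq
      have hc' := hu c hc
      have hq' := hl q hq
      obtain ⟨c, rfl⟩ := exists_eq_succ (hA.1 (mem_of_mem_erase hc))
      obtain ⟨q, rfl⟩ := exists_eq_succ (mem_sdiff.1 hq).1
      rw [extendZero_succ, extendZero_succ, rescale_eq_zero hlt hq', rescale_eq_one hlt hc']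
      exact one_pos
    intro y hy
    exact ⟨A.erase i, insert j A, (erase_subset _ _).trans (subset_insert _ _),
      insert_subset hjJ hA.1, by rw [card_erase_of_mem hi, hA.2],
      by rw [card_insert_of_notMem hj, hA.2], (convex_cone _ _ _).segment_subset hyc hxc hy⟩
  · have e : ((f (g y) : cubeSlab 2 m (n + 1)) : Fin m → ℝ) = y := by
      obtain ⟨hu, hl⟩ := levels_extendZero h1 h2' y.2
      ext i
      change rescale m n (extendZero m y) i = _
      rw [rescale, hu, hl, extendZero_succ, sub_zero, sub_zero, div_one, min_eq_right (y.2.1 i).2,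
        max_eq_right (y.2.1 i).1]
    rw [e, segment_same]
    exact Set.singleton_subset_iff.2 y.2

end JohnsonVR

namespace JohnsonVR

/-- The number of `d`-cells of `cubeSlab d m n` outside a maximal contractible subcomplex. -/
def cellCount : ℕ → ℕ → ℕ → ℕ
  | _, 0, _ => 0
  | _, _ + 1, 0 => 0
  | 0, m + 1, n + 1 => m.choose (n + 1) + cellCount 0 m n
  | d + 1, m + 1, n + 1 => cellCount (d + 1) m (n + 1) + cellCount (d + 1) m n + cellCount d m n

lemma sum_choose_mul_choose (d m n : ℕ) :
    ∑ k ∈ range (n + 1), (m + k - (n + 1)).choose (k + 1) * k.choose (d + 1) +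
      ∑ k ∈ range n, (m + k - n).choose (k + 1) * k.choose d =
    m.choose (n + 1) * n.choose (d + 1) := by
  rw [sum_range_succ', Nat.choose_zero_succ, mul_zero, add_zero, ← sum_add_distrib]
  have h := sum_range_sub (fun k => ((m + k - n).choose (k + 1) * k.choose (d + 1) : ℤ)) n
  simp only [Nat.choose_zero_succ, Nat.cast_zero, mul_zero, sub_zero, Nat.add_sub_cancel] at h
  zify
  rw [← h]
  refine sum_congr rfl fun k _ => ?_
  rw [show m + (k + 1) - (n + 1) = m + k - n by omega]
  rcases le_or_gt n (m + k) with hk | hk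
  · rw [show m + (k + 1) - n = m + k - n + 1 by omega, Nat.choose_succ_succ, Nat.choose_succ_succ]
    push_cast
    ring
  · rw [show m + k - n = 0 by omega, show m + (k + 1) - n = 0 by omega]
    simp

lemma cellCount_eq_sum (d m n : ℕ) :
    cellCount d m n = ∑ k ∈ range n, (m + k - n).choose (k + 1) * k.choose d := by
  induction m generalizing d n with
  | zero =>
    rw [cellCount, sum_eq_zero]
    intro k hk
    rw [Nat.choose_eq_zero_of_lt (by have := mem_range.1 hk; omega), zero_mul]
  | succ m ih =>
    cases n with
    | zero => rw [cellCount, range_zero, sum_empty]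
    | succ n =>
      have e (d : ℕ) : ∑ k ∈ range (n + 1), (m + 1 + k - (n + 1)).choose (k + 1) * k.choose d =
          cellCount d m n + m.choose (n + 1) * n.choose d := by
        rw [sum_range_succ, ih, show m + 1 + n - (n + 1) = m by omega]
        congr 1
        refine sum_congr rfl fun k _ => ?_
        rw [show m + 1 + k - (n + 1) = m + k - n by omega]
      cases d with
      | zero => rw [cellCount, e]; simp [add_comm]
      | succ d =>
        rw [cellCount, e, ← sum_choose_mul_choose, ← ih, ← ih]
        ring

lemma cellCount_two (m n : ℕ) : cellCount 2 m (n + 1) =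
    ∑ k ∈ Icc 2 n, Nat.choose (m + k - 1 - n) (k + 1) * k.choose 2 := by
  rw [cellCount_eq_sum]
  symm
  have : ∀ k, m + k - 1 - n = m + k - (n + 1) := fun k => by omega
  simp_rw [this]
  refine sum_subset (fun k hk => ?_) fun k hk hk' => ?_
  · rw [mem_Icc] at hk; rw [mem_range]; omega
  · rw [mem_Icc] at hk'; rw [mem_range] at hk
    rw [Nat.choose_eq_zero_of_lt (by omega : k < 2), mul_zero]

end JohnsonVR

namespace JohnsonVR

open Fin (tail cons)

/-- The union of `{0} × A₀`, `{1} × A₁` and `[0,1] × B`. -/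
def glue {m : ℕ} (A₀ A₁ B : Set (Fin m → ℝ)) : Set (Fin (m + 1) → ℝ) :=
  {x | (x 0 = 0 ∧ tail x ∈ A₀) ∨ (x 0 = 1 ∧ tail x ∈ A₁) ∨ ((0 ≤ x 0 ∧ x 0 ≤ 1) ∧ tail x ∈ B)}

section glue

variable {m : ℕ} {A₀ A₁ B X₀ X₁ Y : Set (Fin m → ℝ)}

lemma glue_mono (h₀ : A₀ ⊆ X₀) (h₁ : A₁ ⊆ X₁) (h : B ⊆ Y) : glue A₀ A₁ B ⊆ glue X₀ X₁ Y := by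
  rintro x (⟨hx, hm⟩ | ⟨hx, hm⟩ | ⟨hx, hm⟩)
  exacts [Or.inl ⟨hx, h₀ hm⟩, Or.inr (Or.inl ⟨hx, h₁ hm⟩), Or.inr (Or.inr ⟨hx, h hm⟩)]

lemma cons_zero_mem_glue (h : B ⊆ A₀) {u : Fin m → ℝ} :
    (cons 0 u : Fin (m + 1) → ℝ) ∈ glue A₀ A₁ B ↔ u ∈ A₀ := by
  simp only [glue, Set.mem_ofPred_eq, Fin.cons_zero, Fin.tail_cons, zero_ne_one, false_and,
    false_or, true_and, le_refl, zero_le_one]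
  exact or_iff_left_of_imp fun hu => h hu

lemma cons_one_mem_glue (h : B ⊆ A₁) {u : Fin m → ℝ} :
    (cons 1 u : Fin (m + 1) → ℝ) ∈ glue A₀ A₁ B ↔ u ∈ A₁ := by
  simp only [glue, Set.mem_ofPred_eq, Fin.cons_zero, Fin.tail_cons, one_ne_zero, false_and,
    false_or, true_and, le_refl, zero_le_one]
  exact or_iff_left_of_imp fun hu => h hu

lemma mem_glue_of_tail_mem (h₀ : Y ⊆ A₀) (h₁ : Y ⊆ A₁) {x : Fin (m + 1) → ℝ}
    (hx : 0 ≤ x 0 ∧ x 0 ≤ 1) (hY : tail x ∈ Y) :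
    x ∈ glue A₀ A₁ B ↔ (x 0 = 0 ∨ x 0 = 1) ∨ tail x ∈ B := by
  constructor
  · rintro (⟨h, -⟩ | ⟨h, -⟩ | ⟨-, h⟩) <;> tauto
  · rintro ((h | h) | h)
    exacts [Or.inl ⟨h, h₀ hY⟩, Or.inr (Or.inl ⟨h, h₁ hY⟩), Or.inr (Or.inr ⟨hx, h⟩)]

lemma continuous_tail : Continuous (tail : (Fin (m + 1) → ℝ) → Fin m → ℝ) :=
  continuous_pi fun _ => continuous_apply _

lemma isClosed_glue (h₀ : IsClosed A₀) (h₁ : IsClosed A₁) (h : IsClosed B) :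
    IsClosed (glue A₀ A₁ B) := by
  have e : glue A₀ A₁ B = ({x | x 0 = 0} ∩ tail ⁻¹' A₀) ∪ (({x | x 0 = 1} ∩ tail ⁻¹' A₁) ∪
      ({x | 0 ≤ x 0 ∧ x 0 ≤ 1} ∩ tail ⁻¹' B)) := rfl
  rw [e]
  have h0 : Continuous fun x : Fin (m + 1) → ℝ => x 0 := continuous_apply 0
  exact ((isClosed_eq h0 continuous_const).inter (h₀.preimage continuous_tail)).union
    (((isClosed_eq h0 continuous_const).inter (h₁.preimage continuous_tail)).union
      (((isClosed_le continuous_const h0).inter (isClosed_le h0 continuous_const)).inter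
        (h.preimage continuous_tail)))

end glue

lemma cubeSlab_zero (d n : ℕ) : cubeSlab d 0 n = {_x | n ≤ d} := by
  ext x; simp [cubeSlab]

lemma cubeSlab_zero_right (d m : ℕ) : cubeSlab d m 0 = {0} := by
  ext x
  simp only [cubeSlab, Set.mem_ofPred_eq, Set.mem_singleton_iff, nonpos_iff_eq_zero,
    card_eq_zero, zero_le, and_true]
  constructor
  · rintro ⟨-, h⟩
    ext i
    simpa using filter_eq_empty_iff.1 h (mem_univ i)
  · rintro rfl
    simp

lemma mem_cubeSlab_cons {d m n : ℕ} {t : ℝ} {u : Fin m → ℝ} :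
    (cons t u : Fin (m + 1) → ℝ) ∈ cubeSlab d (m + 1) n ↔ (0 ≤ t ∧ t ≤ 1) ∧
      (∀ i, 0 ≤ u i ∧ u i ≤ 1) ∧ (if t ≠ 0 then 1 else 0) + #{i | u i ≠ 0} ≤ n ∧
        n ≤ (if t = 1 then 1 else 0) + #{i | u i = 1} + d := by
  simp only [cubeSlab, Set.mem_ofPred_eq, Fin.forall_fin_succ, Fin.cons_zero, Fin.cons_succ,
    Fin.card_filter_univ_succ, and_assoc]
  congr! 3
  simp only [ite_not]; split_ifs <;> simp [add_comm]

lemma cubeSlab_succ_succ (d m n : ℕ) : cubeSlab (d + 1) (m + 1) (n + 1) =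
    glue (cubeSlab (d + 1) m (n + 1)) (cubeSlab (d + 1) m n) (cubeSlab d m n) := by
  ext x
  rw [← Fin.cons_self_tail x, mem_cubeSlab_cons]
  simp only [glue, Set.mem_ofPred_eq, Fin.cons_zero, Fin.tail_cons, cubeSlab]
  generalize x 0 = t, #{i | tail x i ≠ 0} = z, #{i | tail x i = 1} = o,
    (∀ i, 0 ≤ tail x i ∧ tail x i ≤ 1) = P
  by_cases h0 : t = 0
  · subst h0; simp; grind
  by_cases h1 : t = 1
  · subst h1; simp; grind
  · simp [h0, h1]; grind

lemma cubeSlab_zero_succ_succ (m n : ℕ) : cubeSlab 0 (m + 1) (n + 1) =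
    glue (cubeSlab 0 m (n + 1)) (cubeSlab 0 m n) ∅ := by
  ext x
  rw [← Fin.cons_self_tail x, mem_cubeSlab_cons]
  have : #{i | tail x i = 1} ≤ #{i | tail x i ≠ 0} := card_le_card fun i hi => by
    simp_all
  simp only [glue, Set.mem_ofPred_eq, Fin.cons_zero, Fin.tail_cons, cubeSlab,
    Set.mem_empty_iff_false]
  generalize x 0 = t, #{i | tail x i ≠ 0} = z, #{i | tail x i = 1} = o,
    (∀ i, 0 ≤ tail x i ∧ tail x i ≤ 1) = P at *
  by_cases h0 : t = 0
  · subst h0; simp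
  by_cases h1 : t = 1
  · subst h1; simp; grind
  · simp [h0, h1]; grind

end JohnsonVR

namespace JohnsonVR

open Fin (tail cons)

/-- A contractible subcomplex of `cubeSlab d m n` containing its `(d - 1)`-skeleton. -/
def cubeTree : ℕ → (m : ℕ) → ℕ → Set (Fin m → ℝ)
  | d, 0, n => {_x | n ≤ d}
  | _, _ + 1, 0 => {0}
  | 0, m + 1, n + 1 => glue ∅ (cubeTree 0 m n) ∅
  | d + 1, m + 1, n + 1 =>
    glue (cubeTree (d + 1) m (n + 1)) (cubeTree (d + 1) m n) (cubeTree d m n)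

lemma cubeTree_zero_right (d m : ℕ) : cubeTree d m 0 = {0} := by
  cases m with
  | zero => ext x; simp [cubeTree, Subsingleton.elim x 0]
  | succ m => simp [cubeTree]

lemma cubeTree_subset (d m n : ℕ) : cubeTree d m n ⊆ cubeSlab d m n := by
  induction m generalizing d n with
  | zero => rw [cubeSlab_zero, cubeTree]
  | succ m ih =>
    cases n with
    | zero => rw [cubeSlab_zero_right, cubeTree]
    | succ n =>
      cases d with
      | zero =>
        rw [cubeSlab_zero_succ_succ, cubeTree]
        exact glue_mono (Set.empty_subset _) (ih _ _) subset_rfl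
      | succ d =>
        rw [cubeSlab_succ_succ, cubeTree]
        exact glue_mono (ih _ _) (ih _ _) (ih _ _)

lemma cubeSlab_subset_cubeTree (d m n : ℕ) : cubeSlab d m n ⊆ cubeTree (d + 1) m n ∧
    cubeSlab d m n ⊆ cubeTree (d + 1) m (n + 1) := by
  induction m generalizing d n with
  | zero =>
    rw [cubeSlab_zero, cubeTree, cubeTree]
    exact ⟨fun _ h => Nat.le_succ_of_le h, fun _ h => Nat.succ_le_succ h⟩
  | succ m ih =>
    cases n with
    | zero =>
      rw [cubeSlab_zero_right, cubeTree_zero_right, cubeTree]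
      refine ⟨subset_rfl, Set.singleton_subset_iff.2 (Or.inl ⟨rfl, (ih d 0).2 ?_⟩)⟩
      rw [cubeSlab_zero_right]
      rfl
    | succ n =>
      cases d with
      | zero =>
        rw [cubeSlab_zero_succ_succ, cubeTree, cubeTree]
        exact ⟨glue_mono (ih _ _).1 (ih _ _).1 (Set.empty_subset _),
          glue_mono (ih _ _).2 (ih _ _).2 (Set.empty_subset _)⟩
      | succ d =>
        rw [cubeSlab_succ_succ, cubeTree, cubeTree]
        exact ⟨glue_mono (ih _ _).1 (ih _ _).1 (ih _ _).1,
          glue_mono (ih _ _).2 (ih _ _).2 (ih _ _).2⟩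

lemma isClosed_cubeTree (d m n : ℕ) : IsClosed (cubeTree d m n) := by
  induction m generalizing d n with
  | zero => exact (Set.toFinite _).isClosed
  | succ m ih =>
    cases n with
    | zero => rw [cubeTree]; exact isClosed_singleton
    | succ n =>
      cases d with
      | zero => exact isClosed_glue isClosed_empty (ih _ _) isClosed_empty
      | succ d => exact isClosed_glue (ih _ _) (ih _ _) (ih _ _)

lemma isClosed_cubeSlab (d m n : ℕ) : IsClosed (cubeSlab d m n) := by
  induction m generalizing d n with
  | zero => exact (Set.toFinite _).isClosed
  | succ m ih =>
    cases n with
    | zero => rw [cubeSlab_zero_right]; exact isClosed_singleton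
    | succ n =>
      cases d with
      | zero =>
        rw [cubeSlab_zero_succ_succ]
        exact isClosed_glue (ih _ _) (ih _ _) isClosed_empty
      | succ d =>
        rw [cubeSlab_succ_succ]
        exact isClosed_glue (ih _ _) (ih _ _) (ih _ _)

/-- The unit cube in `ℝ^d`. -/
def unitCube (d : ℕ) : Set (Fin d → ℝ) := {y | ∀ k, 0 ≤ y k ∧ y k ≤ 1}

lemma isCompact_unitCube (d : ℕ) : IsCompact (unitCube d) := by
  have e : unitCube d = Set.univ.pi fun _ => Set.Icc (0 : ℝ) 1 := by
    ext y; simp only [unitCube, Set.mem_ofPred_eq, Set.mem_pi, Set.mem_univ, true_imp_iff, Set.mem_Icc]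
  rw [e]
  exact isCompact_univ_pi fun _ => isCompact_Icc

lemma isCompact_cubeSlab (d m n : ℕ) : IsCompact (cubeSlab d m n) :=
  (isCompact_unitCube m).of_isClosed_subset (isClosed_cubeSlab d m n) fun _ hy => hy.1

/-- The vector with first coordinate `t` followed by `u`. -/
abbrev prepend {m : ℕ} (t : ℝ) (u : Fin m → ℝ) : Fin (m + 1) → ℝ := cons t u

lemma continuous_prepend {m : ℕ} (t : ℝ) : Continuous (prepend t : (Fin m → ℝ) → _) :=
  Continuous.finCons (A := fun _ => ℝ) continuous_const continuous_id

/-- Characteristic maps, indexed by `ι`, exhibiting `X` as obtained from `A` by attaching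
`d`-dimensional cubes along their boundaries. -/
structure CellData (d : ℕ) {m : ℕ} (A X : Set (Fin m → ℝ)) (ι : Type) where
  char : ι → (Fin d → ℝ) → Fin m → ℝ
  cont : ∀ i, Continuous (char i)
  mem : ∀ i, ∀ y ∈ unitCube d, char i y ∈ X
  mem_iff : ∀ i, ∀ y ∈ unitCube d, char i y ∈ A ↔ ∃ k, y k = 0 ∨ y k = 1
  inj : ∀ i j, ∀ y ∈ unitCube d, ∀ z ∈ unitCube d, char i y ∉ A → char i y = char j z →
    i = j ∧ y = z
  cover : ∀ x ∈ X, x ∉ A → ∃ i, ∃ y ∈ unitCube d, char i y = x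

namespace CellData

variable {d m : ℕ} {A X A₀ A₁ B X₀ X₁ Y : Set (Fin m → ℝ)} {ι ι₀ ι₁ ι₂ : Type}

/-- No cells are attached when the two sets agree. -/
def refl (d : ℕ) (A : Set (Fin m → ℝ)) : CellData d A A Empty where
  char i := i.elim
  cont i := i.elim
  mem i := i.elim
  mem_iff i := i.elim
  inj i := i.elim
  cover _ hx h := absurd hx h

/-- A single point is a zero-dimensional cell. -/
def point (a : Fin m → ℝ) : CellData 0 ∅ {a} Unit where
  char _ _ := a
  cont _ := continuous_const
  mem _ _ _ := rfl
  mem_iff _ _ _ := by simp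
  inj _ _ y _ z _ _ _ := ⟨rfl, Subsingleton.elim y z⟩
  cover _ hx _ := ⟨(), 0, fun k => k.elim0, hx.symm⟩


/-- The cells of the ends of a glued set. -/
def glueEnds (D₀ : CellData d A₀ X₀ ι₀) (D₁ : CellData d A₁ X₁ ι₁) :
    CellData d (glue A₀ A₁ ∅) (glue X₀ X₁ ∅) (ι₀ ⊕ ι₁) where
  char := Sum.elim (fun i y => prepend 0 (D₀.char i y)) (fun i y => prepend 1 (D₁.char i y))
  cont := by
    rintro (i | i)
    exacts [(continuous_prepend 0).comp (D₀.cont i), (continuous_prepend 1).comp (D₁.cont i)]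
  mem := by
    rintro (i | i) y hy
    · exact (cons_zero_mem_glue (Set.empty_subset _)).2 (D₀.mem i y hy)
    · exact (cons_one_mem_glue (Set.empty_subset _)).2 (D₁.mem i y hy)
  mem_iff := by
    rintro (i | i) y hy
    · exact (cons_zero_mem_glue (Set.empty_subset _)).trans (D₀.mem_iff i y hy)
    · exact (cons_one_mem_glue (Set.empty_subset _)).trans (D₁.mem_iff i y hy)
  inj := by
    rintro (i | i) (j | j) y hy z hz hA h <;> obtain ⟨h1, h2⟩ := Fin.cons_inj (α := fun _ => ℝ).1 h
    · obtain ⟨rfl, rfl⟩ := D₀.inj i j y hy z hz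
        (fun h => hA ((cons_zero_mem_glue (Set.empty_subset _)).2 h)) h2
      exact ⟨rfl, rfl⟩
    · exact absurd h1 zero_ne_one
    · exact absurd h1 one_ne_zero
    · obtain ⟨rfl, rfl⟩ := D₁.inj i j y hy z hz
        (fun h => hA ((cons_one_mem_glue (Set.empty_subset _)).2 h)) h2
      exact ⟨rfl, rfl⟩
  cover := by
    rintro x (⟨hx, hm⟩ | ⟨hx, hm⟩ | ⟨hx, hm⟩) hA
    · obtain ⟨i, y, hy, e⟩ := D₀.cover _ hm fun h => hA (Or.inl ⟨hx, h⟩)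
      exact ⟨Sum.inl i, y, hy, by rw [← Fin.cons_self_tail x, hx, ← e]; rfl⟩
    · obtain ⟨i, y, hy, e⟩ := D₁.cover _ hm fun h => hA (Or.inr (Or.inl ⟨hx, h⟩))
      exact ⟨Sum.inr i, y, hy, by rw [← Fin.cons_self_tail x, hx, ← e]; rfl⟩
    · exact hm.elim

/-- The cells of a glued set. -/
def glue (D₀ : CellData (d + 1) A₀ X₀ ι₀) (D₁ : CellData (d + 1) A₁ X₁ ι₁)
    (D : CellData d B Y ι₂) (hB : B ⊆ Y) (h₀ : Y ⊆ A₀) (h₁ : Y ⊆ A₁) (h₀' : A₀ ⊆ X₀)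
    (h₁' : A₁ ⊆ X₁) :
    CellData (d + 1) (JohnsonVR.glue A₀ A₁ B) (JohnsonVR.glue X₀ X₁ Y) ((ι₀ ⊕ ι₁) ⊕ ι₂) where
  char := Sum.elim
    (Sum.elim (fun i y => prepend 0 (D₀.char i y)) (fun i y => prepend 1 (D₁.char i y)))
    (fun i y => prepend (y 0) (D.char i (tail y)))
  cont := by
    rintro ((i | i) | i)
    · exact (continuous_prepend 0).comp (D₀.cont i)
    · exact (continuous_prepend 1).comp (D₁.cont i)
    · exact Continuous.finCons (A := fun _ => ℝ) (continuous_apply 0) ((D.cont i).comp continuous_tail)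
  mem := by
    rintro ((i | i) | i) y hy
    · exact (cons_zero_mem_glue (h₀.trans h₀')).2 (D₀.mem i y hy)
    · exact (cons_one_mem_glue (h₁.trans h₁')).2 (D₁.mem i y hy)
    · exact Or.inr (Or.inr ⟨hy 0, D.mem i _ fun k => hy k.succ⟩)
  mem_iff := by
    rintro ((i | i) | i) y hy
    · exact (cons_zero_mem_glue (hB.trans h₀)).trans (D₀.mem_iff i y hy)
    · exact (cons_one_mem_glue (hB.trans h₁)).trans (D₁.mem_iff i y hy)
    · refine (mem_glue_of_tail_mem (x := prepend (y 0) (D.char i (tail y))) h₀ h₁ (hy 0)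
        (D.mem i _ fun k => hy k.succ)).trans ?_
      rw [Fin.exists_fin_succ]
      exact or_congr Iff.rfl (D.mem_iff i _ fun k => hy k.succ)
  inj := by
    have key : ∀ y ∈ unitCube (d + 1), ∀ i,
        prepend (y 0) (D.char i (tail y)) ∉ JohnsonVR.glue A₀ A₁ B →
        y 0 ≠ 0 ∧ y 0 ≠ 1 ∧ D.char i (tail y) ∉ B := fun y hy i h => by
      rw [mem_glue_of_tail_mem (x := prepend (y 0) (D.char i (tail y))) h₀ h₁ (hy 0)
        (D.mem i _ fun k => hy k.succ), not_or, not_or] at h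
      exact ⟨h.1.1, h.1.2, h.2⟩
    rintro ((i | i) | i) ((j | j) | j) y hy z hz hA h <;> obtain ⟨h1, h2⟩ := Fin.cons_inj (α := fun _ => ℝ).1 h
    · obtain ⟨rfl, rfl⟩ := D₀.inj i j y hy z hz
        (fun h => hA ((cons_zero_mem_glue (hB.trans h₀)).2 h)) h2
      exact ⟨rfl, rfl⟩
    · exact absurd h1 zero_ne_one
    · exact absurd h1.symm (key z hz j fun hm => hA (h ▸ hm)).1
    · exact absurd h1 one_ne_zero
    · obtain ⟨rfl, rfl⟩ := D₁.inj i j y hy z hz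
        (fun h => hA ((cons_one_mem_glue (hB.trans h₁)).2 h)) h2
      exact ⟨rfl, rfl⟩
    · exact absurd h1.symm (key z hz j fun hm => hA (h ▸ hm)).2.1
    · exact absurd h1 (key y hy i hA).1
    · exact absurd h1 (key y hy i hA).2.1
    · obtain ⟨rfl, e⟩ := D.inj i j (tail y) (fun k => hy k.succ) (tail z) (fun k => hz k.succ)
        (key y hy i hA).2.2 h2
      exact ⟨rfl, by rw [← Fin.cons_self_tail y, ← Fin.cons_self_tail z, h1, e]⟩
  cover := by
    rintro x (⟨hx, hm⟩ | ⟨hx, hm⟩ | ⟨hx, hm⟩) hA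
    · obtain ⟨i, y, hy, e⟩ := D₀.cover _ hm fun h => hA (Or.inl ⟨hx, h⟩)
      exact ⟨Sum.inl (Sum.inl i), y, hy, by rw [← Fin.cons_self_tail x, hx, ← e]; rfl⟩
    · obtain ⟨i, y, hy, e⟩ := D₁.cover _ hm fun h => hA (Or.inr (Or.inl ⟨hx, h⟩))
      exact ⟨Sum.inl (Sum.inr i), y, hy, by rw [← Fin.cons_self_tail x, hx, ← e]; rfl⟩
    · obtain ⟨i, y, hy, e⟩ := D.cover _ hm fun h => hA (Or.inr (Or.inr ⟨hx, h⟩))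
      refine ⟨Sum.inr i, cons (x 0) y, Fin.forall_fin_succ.2 ⟨hx, hy⟩, ?_⟩
      rw [← Fin.cons_self_tail x, ← e]
      rfl

end CellData

lemma glue_empty {m : ℕ} : glue (∅ : Set (Fin m → ℝ)) ∅ ∅ = ∅ := by
  ext x; simp [glue]

lemma exists_cellData_empty (m n : ℕ) : ∃ (ι : Type) (_ : Fintype ι),
    Fintype.card ι = m.choose n ∧ Nonempty (CellData 0 ∅ (cubeSlab 0 m n) ι) := by
  induction m generalizing n with
  | zero =>
    cases n with
    | zero =>
      rw [cubeSlab_zero_right]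
      exact ⟨Unit, inferInstance, rfl, ⟨CellData.point 0⟩⟩
    | succ n =>
      have e : cubeSlab 0 0 (n + 1) = ∅ := by ext; simp [cubeSlab_zero]
      rw [e]
      exact ⟨Empty, inferInstance, rfl, ⟨CellData.refl 0 ∅⟩⟩
  | succ m ih =>
    cases n with
    | zero =>
      rw [cubeSlab_zero_right]
      exact ⟨Unit, inferInstance, rfl, ⟨CellData.point 0⟩⟩
    | succ n =>
      obtain ⟨ι₀, _, h₀, ⟨D₀⟩⟩ := ih (n + 1)
      obtain ⟨ι₁, _, h₁, ⟨D₁⟩⟩ := ih n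
      rw [cubeSlab_zero_succ_succ, ← glue_empty]
      refine ⟨ι₀ ⊕ ι₁, inferInstance, ?_, ⟨D₀.glueEnds D₁⟩⟩
      rw [Fintype.card_sum, h₀, h₁, Nat.choose_succ_succ, add_comm]

lemma exists_cellData (d m n : ℕ) : ∃ (ι : Type) (_ : Fintype ι),
    Fintype.card ι = cellCount d m n ∧
      Nonempty (CellData d (cubeTree d m n) (cubeSlab d m n) ι) := by
  induction m generalizing d n with
  | zero =>
    rw [cubeSlab_zero, cubeTree, cellCount]
    exact ⟨Empty, inferInstance, rfl, ⟨CellData.refl d _⟩⟩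
  | succ m ih =>
    cases n with
    | zero =>
      rw [cubeSlab_zero_right, cubeTree, cellCount]
      exact ⟨Empty, inferInstance, rfl, ⟨CellData.refl d _⟩⟩
    | succ n =>
      cases d with
      | zero =>
        obtain ⟨ι₀, _, h₀, ⟨D₀⟩⟩ := exists_cellData_empty m (n + 1)
        obtain ⟨ι₁, _, h₁, ⟨D₁⟩⟩ := ih 0 n
        rw [cubeSlab_zero_succ_succ, cubeTree, cellCount]
        exact ⟨ι₀ ⊕ ι₁, inferInstance, by rw [Fintype.card_sum, h₀, h₁], ⟨D₀.glueEnds D₁⟩⟩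
      | succ d =>
        obtain ⟨ι₀, _, h₀, ⟨D₀⟩⟩ := ih (d + 1) (n + 1)
        obtain ⟨ι₁, _, h₁, ⟨D₁⟩⟩ := ih (d + 1) n
        obtain ⟨ι₂, _, h₂, ⟨D⟩⟩ := ih d n
        rw [cubeSlab_succ_succ, cubeTree, cellCount]
        exact ⟨(ι₀ ⊕ ι₁) ⊕ ι₂, inferInstance,
          by rw [Fintype.card_sum, Fintype.card_sum, h₀, h₁, h₂],
          ⟨D₀.glue D₁ D (cubeTree_subset _ _ _) (cubeSlab_subset_cubeTree _ _ _).2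
            (cubeSlab_subset_cubeTree _ _ _).1 (cubeTree_subset _ _ _) (cubeTree_subset _ _ _)⟩⟩

end JohnsonVR

namespace JohnsonVR

open Fin (tail cons)
open scoped unitInterval

lemma exists_contraction {E : Type*} [TopologicalSpace E] (A : Set E) [ContractibleSpace A] :
    ∃ a ∈ A, ∃ F : ℝ × E → E, ContinuousOn F (Set.Icc 0 1 ×ˢ A) ∧ Set.MapsTo F (Set.univ ×ˢ A) A ∧
      (∀ v ∈ A, F (0, v) = v) ∧ (∀ v ∈ A, F (1, v) = a) ∧ ∀ s, ∀ v ∉ A, F (s, v) = v := by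
  classical
  obtain ⟨a, ⟨H⟩⟩ := (contractible_iff_id_nullhomotopic A).1 inferInstance
  refine ⟨a, a.2, fun p => if h : p.2 ∈ A then
    (H (Set.projIcc 0 1 zero_le_one p.1, ⟨p.2, h⟩) : E) else p.2, ?_, ?_, ?_, ?_, ?_⟩
  · rw [continuousOn_iff_continuous_domRestrict]
    have : Continuous fun p : (Set.Icc (0 : ℝ) 1 ×ˢ A : Set (ℝ × E)) =>
        (H (Set.projIcc 0 1 zero_le_one p.1.1, ⟨p.1.2, p.2.2⟩) : E) := by
      refine continuous_subtype_val.comp (H.continuous.comp ?_)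
      refine (continuous_projIcc.comp (continuous_fst.comp continuous_subtype_val)).prodMk ?_
      exact (continuous_snd.comp continuous_subtype_val).subtype_mk _
    refine this.congr fun p => ?_
    simp [Set.domRestrict, p.2.2]
  · rintro p ⟨-, hp⟩
    simp only [dif_pos hp]
    exact Subtype.coe_prop _
  · intro v hv
    simp [hv]
  · intro v hv
    simp [hv]
  · intro s v hv
    simp [hv]

lemma exists_homotopic_of_continuousOn {E : Type*} [TopologicalSpace E] {M : Set E}
    {H : ℝ × E → E} (hc : ContinuousOn H (Set.Icc 0 1 ×ˢ M))
    (hM : Set.MapsTo H (Set.Icc 0 1 ×ˢ M) M) : ∃ f g : C(M, M), (∀ x : M, (f x : E) = H (0, x)) ∧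
      (∀ x : M, (g x : E) = H (1, x)) ∧ f.Homotopic g := by
  have hc' : Continuous fun p : I × M => (⟨H (p.1, p.2), hM ⟨p.1.2, p.2.2⟩⟩ : M) := by
    refine Continuous.subtype_mk ?_ _
    refine hc.comp_continuous (f := fun p : I × M => ((p.1 : ℝ), (p.2 : E))) (by fun_prop)
      fun p => ⟨p.1.2, p.2.2⟩
  refine ⟨⟨fun x => ⟨H (0, x), hM ⟨by simp, x.2⟩⟩, hc'.comp (f := fun x => (0, x)) (by fun_prop)⟩,
    ⟨fun x => ⟨H (1, x), hM ⟨by simp, x.2⟩⟩, hc'.comp (f := fun x => (1, x)) (by fun_prop)⟩,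
    fun x => rfl, fun x => rfl, ⟨⟨⟨_, hc'⟩, fun x => ?_, fun x => ?_⟩⟩⟩ <;>
  ext <;> simp

lemma contractibleSpace_of_three_homotopies {E : Type*} [TopologicalSpace E] {M : Set E}
    {H₁ H₂ H₃ : ℝ × E → E} {c : E} (hc : c ∈ M)
    (hc₁ : ContinuousOn H₁ (Set.Icc 0 1 ×ˢ M)) (hm₁ : Set.MapsTo H₁ (Set.Icc 0 1 ×ˢ M) M)
    (hc₂ : ContinuousOn H₂ (Set.Icc 0 1 ×ˢ M)) (hm₂ : Set.MapsTo H₂ (Set.Icc 0 1 ×ˢ M) M)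
    (hc₃ : ContinuousOn H₃ (Set.Icc 0 1 ×ˢ M)) (hm₃ : Set.MapsTo H₃ (Set.Icc 0 1 ×ˢ M) M)
    (h0 : ∀ x ∈ M, H₁ (0, x) = x) (h12 : ∀ x ∈ M, H₁ (1, x) = H₂ (0, x))
    (h23 : ∀ x ∈ M, H₂ (1, x) = H₃ (0, x)) (h3 : ∀ x ∈ M, H₃ (1, x) = c) :
    ContractibleSpace M := by
  obtain ⟨f₁, g₁, hf₁, hg₁, h₁⟩ := exists_homotopic_of_continuousOn hc₁ hm₁
  obtain ⟨f₂, g₂, hf₂, hg₂, h₂⟩ := exists_homotopic_of_continuousOn hc₂ hm₂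
  obtain ⟨f₃, g₃, hf₃, hg₃, h₃⟩ := exists_homotopic_of_continuousOn hc₃ hm₃
  have e0 : f₁ = ContinuousMap.id M := by ext x; rw [hf₁, h0 x x.2]; rfl
  have e1 : f₂ = g₁ := by ext x; rw [hf₂, hg₁, h12 x x.2]
  have e2 : f₃ = g₂ := by ext x; rw [hf₃, hg₂, h23 x x.2]
  have e3 : g₃ = ContinuousMap.const M ⟨c, hc⟩ := by ext x; rw [hg₃, h3 x x.2]; rfl
  subst e1 e2
  rw [e0] at h₁
  rw [e3] at h₃
  exact (contractible_iff_id_nullhomotopic M).2 ⟨_, (h₁.trans h₂).trans h₃⟩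

section

variable {m : ℕ} (F₀ F₁ : ℝ × (Fin m → ℝ) → Fin m → ℝ)

/-- The map from a cylinder with long ends which follows `F₀` below height `0` and `F₁` above
height `1`. -/
noncomputable def stretch (p : ℝ × (Fin m → ℝ)) : Fin (m + 1) → ℝ :=
  if p.1 ≤ 0 then prepend 0 (F₀ (-p.1, p.2))
  else if p.1 ≤ 1 then prepend p.1 p.2 else prepend 1 (F₁ (p.1 - 1, p.2))

variable {F₀ F₁} {A₀ A₁ B : Set (Fin m → ℝ)}

/-- The domain of `stretch`. -/
def stretchDom (A₀ A₁ B : Set (Fin m → ℝ)) : Set (ℝ × (Fin m → ℝ)) :=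
  (Set.Icc (-1) 0 ×ˢ A₀ ∪ Set.Icc 0 1 ×ˢ B) ∪ Set.Icc 1 2 ×ˢ A₁

lemma stretch_low {w : ℝ} {v : Fin m → ℝ} (hw : w ≤ 0) :
    stretch F₀ F₁ (w, v) = prepend 0 (F₀ (-w, v)) := if_pos hw

lemma stretch_mid {w : ℝ} {v : Fin m → ℝ} (hw : 0 ≤ w ∧ w ≤ 1) (hv : F₀ (0, v) = v) :
    stretch F₀ F₁ (w, v) = prepend w v := by
  rcases hw.1.eq_or_lt with rfl | h
  · rw [stretch_low le_rfl, neg_zero, hv]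
  · rw [stretch, if_neg h.not_ge, if_pos hw.2]

lemma stretch_high {w : ℝ} {v : Fin m → ℝ} (hw : 1 ≤ w) (hv : F₁ (0, v) = v) :
    stretch F₀ F₁ (w, v) = prepend 1 (F₁ (w - 1, v)) := by
  have h0 : ¬ w ≤ 0 := by linarith
  rcases hw.eq_or_lt with rfl | h
  · rw [stretch, if_neg h0, if_pos le_rfl, sub_self, hv]
  · rw [stretch, if_neg h0, if_neg h.not_ge]

lemma continuous_prepend_uncurry : Continuous fun p : ℝ × (Fin m → ℝ) => prepend p.1 p.2 :=
  Continuous.finCons (A := fun _ => ℝ) continuous_fst continuous_snd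

lemma continuousOn_stretch (h₀ : IsClosed A₀) (h₁ : IsClosed A₁) (h : IsClosed B) (hB₀ : B ⊆ A₀)
    (c₀ : ContinuousOn F₀ (Set.Icc 0 1 ×ˢ A₀)) (c₁ : ContinuousOn F₁ (Set.Icc 0 1 ×ˢ A₁))
    (z₀ : ∀ v ∈ A₀, F₀ (0, v) = v) (z₁ : ∀ v ∈ A₁, F₁ (0, v) = v) :
    ContinuousOn (stretch F₀ F₁) (stretchDom A₀ A₁ B) := by
  refine ContinuousOn.union_of_isClosed (ContinuousOn.union_of_isClosed ?_ ?_
    (isClosed_Icc.prod h₀) (isClosed_Icc.prod h)) ?_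
    ((isClosed_Icc.prod h₀).union (isClosed_Icc.prod h)) (isClosed_Icc.prod h₁)
  · refine ContinuousOn.congr (f := fun p => prepend 0 (F₀ (-p.1, p.2))) ?_
      fun p hp => stretch_low hp.1.2
    refine (continuous_prepend 0).comp_continuousOn (c₀.comp (by fun_prop) ?_)
    rintro p ⟨⟨ha, hb⟩, hv⟩
    exact ⟨⟨by simpa using hb, by simp only; linarith⟩, hv⟩
  · exact continuous_prepend_uncurry.continuousOn.congr fun p hp =>
      stretch_mid hp.1 (z₀ _ (hB₀ hp.2))
  · refine ContinuousOn.congr (f := fun p => prepend 1 (F₁ (p.1 - 1, p.2))) ?_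
      fun p hp => stretch_high hp.1.1 (z₁ _ hp.2)
    refine (continuous_prepend 1).comp_continuousOn (c₁.comp (by fun_prop) ?_)
    rintro p ⟨⟨ha, hb⟩, hv⟩
    exact ⟨⟨by simpa using ha, by simp only; linarith⟩, hv⟩

lemma mapsTo_stretch (hB₀ : B ⊆ A₀) (hB₁ : B ⊆ A₁)
    (m₀ : Set.MapsTo F₀ (Set.univ ×ˢ A₀) A₀) (m₁ : Set.MapsTo F₁ (Set.univ ×ˢ A₁) A₁)
    (z₀ : ∀ v ∈ A₀, F₀ (0, v) = v) (z₁ : ∀ v ∈ A₁, F₁ (0, v) = v) :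
    Set.MapsTo (stretch F₀ F₁) (stretchDom A₀ A₁ B) (glue A₀ A₁ B) := by
  rintro ⟨w, v⟩ ((⟨hw, hv⟩ | ⟨hw, hv⟩) | ⟨hw, hv⟩)
  · rw [stretch_low hw.2]
    exact (cons_zero_mem_glue hB₀).2 (m₀ ⟨trivial, hv⟩)
  · rw [stretch_mid hw (z₀ _ (hB₀ hv))]
    exact Or.inr (Or.inr ⟨hw, hv⟩)
  · rw [stretch_high hw.1 (z₁ _ hv)]
    exact (cons_one_mem_glue hB₁).2 (m₁ ⟨trivial, hv⟩)

lemma contractibleSpace_glue (h₀ : IsClosed A₀) (h₁ : IsClosed A₁) (h : IsClosed B) (hB₀ : B ⊆ A₀)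
    (hB₁ : B ⊆ A₁) [ContractibleSpace A₀] [ContractibleSpace A₁] [ContractibleSpace B] :
    ContractibleSpace (glue A₀ A₁ B) := by
  obtain ⟨a₀, ha₀, F₀, c₀, m₀, z₀, e₀, -⟩ := exists_contraction A₀
  obtain ⟨a₁, ha₁, F₁, c₁, m₁, z₁, e₁, -⟩ := exists_contraction A₁
  obtain ⟨b, hb, K, cK, mK, zK, eK, nK⟩ := exists_contraction B
  have hcont := continuousOn_stretch h₀ h₁ h hB₀ c₀ c₁ z₀ z₁
  have hmaps := mapsTo_stretch hB₀ hB₁ m₀ m₁ z₀ z₁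
  have low : ∀ v ∈ A₀, stretch F₀ F₁ (-1, v) = prepend 0 a₀ := fun v hv => by
    rw [stretch_low (by norm_num), neg_neg, e₀ v hv]
  have high : ∀ v ∈ A₁, stretch F₀ F₁ (2, v) = prepend 1 a₁ := fun v hv => by
    rw [stretch_high (by norm_num) (z₁ v hv), show (2 : ℝ) - 1 = 1 by norm_num, e₁ v hv]
  have key : ∀ v ∈ B, ∀ w : ℝ, -1 ≤ w → w ≤ 2 → (w, v) ∈ stretchDom A₀ A₁ B := by
    intro v hv w hw1 hw2
    rcases le_or_gt w 0 with hw | hw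
    · exact Or.inl (Or.inl ⟨⟨hw1, hw⟩, hB₀ hv⟩)
    rcases le_or_gt w 1 with hw' | hw'
    · exact Or.inl (Or.inr ⟨⟨hw.le, hw'⟩, hv⟩)
    · exact Or.inr ⟨⟨hw'.le, hw2⟩, hB₁ hv⟩
  have cu : Continuous fun p : ℝ × (Fin (m + 1) → ℝ) => p.2 0 :=
    (continuous_apply 0).comp continuous_snd
  have ct : Continuous fun p : ℝ × (Fin (m + 1) → ℝ) => tail p.2 :=
    continuous_tail.comp continuous_snd
  have dom₁ : Set.MapsTo (fun p : ℝ × (Fin (m + 1) → ℝ) => ((1 + 2 * p.1) * p.2 0 - p.1, tail p.2))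
      (Set.Icc 0 1 ×ˢ glue A₀ A₁ B) (stretchDom A₀ A₁ B) := by
    rintro ⟨s, x⟩ ⟨⟨hs0, hs1⟩, ⟨hx, hm⟩ | ⟨hx, hm⟩ | ⟨hx, hm⟩⟩ <;> simp only at *
    · rw [hx]; exact Or.inl (Or.inl ⟨⟨by linarith, by linarith⟩, hm⟩)
    · rw [hx]; exact Or.inr ⟨⟨by linarith, by linarith⟩, hm⟩
    · exact key _ hm _ (by nlinarith) (by nlinarith)
  have dom₂ : Set.MapsTo (fun p : ℝ × (Fin (m + 1) → ℝ) => (3 * p.2 0 - 1, K (p.1, tail p.2)))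
      (Set.Icc 0 1 ×ˢ {x : Fin (m + 1) → ℝ | (0 ≤ x 0 ∧ x 0 ≤ 1) ∧ tail x ∈ B}) (stretchDom A₀ A₁ B) := by
    rintro ⟨s, x⟩ ⟨hs, hx, hm⟩
    exact key _ (mK ⟨trivial, hm⟩) _ (by simp only at *; linarith) (by simp only at *; linarith)
  have low₂ : ∀ s, ∀ x ∈ {x : Fin (m + 1) → ℝ | x 0 = 0 ∧ tail x ∈ A₀},
      stretch F₀ F₁ (3 * x 0 - 1, K (s, tail x)) = prepend 0 a₀ := by
    rintro s x ⟨hx, hm⟩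
    rw [hx, mul_zero, zero_sub]
    by_cases hv : tail x ∈ B
    · exact low _ (hB₀ (mK ⟨trivial, hv⟩))
    · rw [nK _ _ hv, low _ hm]
  have high₂ : ∀ s, ∀ x ∈ {x : Fin (m + 1) → ℝ | x 0 = 1 ∧ tail x ∈ A₁},
      stretch F₀ F₁ (3 * x 0 - 1, K (s, tail x)) = prepend 1 a₁ := by
    rintro s x ⟨hx, hm⟩
    rw [hx, mul_one, show (3 : ℝ) - 1 = 2 by norm_num]
    by_cases hv : tail x ∈ B
    · exact high _ (hB₁ (mK ⟨trivial, hv⟩))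
    · rw [nK _ _ hv, high _ hm]
  have hI : ∀ x ∈ glue A₀ A₁ B, 0 ≤ x 0 ∧ x 0 ≤ 1 := by
    rintro x (⟨hx, -⟩ | ⟨hx, -⟩ | ⟨hx, -⟩)
    · rw [hx]; norm_num
    · rw [hx]; norm_num
    · exact hx
  have dom₃ : Set.MapsTo (fun p : ℝ × (Fin (m + 1) → ℝ) => (3 * ((1 - p.1) * p.2 0) - 1, b))
      (Set.Icc 0 1 ×ˢ glue A₀ A₁ B) (stretchDom A₀ A₁ B) := by
    rintro ⟨s, x⟩ ⟨⟨hs0, hs1⟩, hx⟩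
    obtain ⟨hx0, hx1⟩ := hI x hx
    simp only at *
    exact key _ hb _ (by nlinarith) (by nlinarith)
  refine contractibleSpace_of_three_homotopies
    (H₁ := fun p => stretch F₀ F₁ ((1 + 2 * p.1) * p.2 0 - p.1, tail p.2))
    (H₂ := fun p => stretch F₀ F₁ (3 * p.2 0 - 1, K (p.1, tail p.2)))
    (H₃ := fun p => stretch F₀ F₁ (3 * ((1 - p.1) * p.2 0) - 1, b))
    (c := prepend 0 a₀) (Or.inl ⟨rfl, ha₀⟩) ?_ (fun p hp => hmaps (dom₁ hp)) ?_ ?_ ?_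
    (fun p hp => hmaps (dom₃ hp)) ?_ ?_ ?_ ?_
  · exact hcont.comp (Continuous.continuousOn (by fun_prop)) dom₁
  · have e : Set.Icc (0 : ℝ) 1 ×ˢ glue A₀ A₁ B =
        (Set.Icc (0 : ℝ) 1 ×ˢ {x : Fin (m + 1) → ℝ | x 0 = 0 ∧ tail x ∈ A₀} ∪
          Set.Icc (0 : ℝ) 1 ×ˢ {x : Fin (m + 1) → ℝ | x 0 = 1 ∧ tail x ∈ A₁}) ∪
          Set.Icc (0 : ℝ) 1 ×ˢ {x : Fin (m + 1) → ℝ | (0 ≤ x 0 ∧ x 0 ≤ 1) ∧ tail x ∈ B} := by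
      rw [← Set.prod_union, ← Set.prod_union, Set.union_assoc]
      rfl
    have hu : Continuous fun x : Fin (m + 1) → ℝ => x 0 := continuous_apply 0
    have d₀ : IsClosed {x : Fin (m + 1) → ℝ | x 0 = 0 ∧ tail x ∈ A₀} :=
      (isClosed_eq hu continuous_const).inter (h₀.preimage continuous_tail)
    have d₁ : IsClosed {x : Fin (m + 1) → ℝ | x 0 = 1 ∧ tail x ∈ A₁} :=
      (isClosed_eq hu continuous_const).inter (h₁.preimage continuous_tail)
    have d : IsClosed {x : Fin (m + 1) → ℝ | (0 ≤ x 0 ∧ x 0 ≤ 1) ∧ tail x ∈ B} :=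
      ((isClosed_le continuous_const hu).inter (isClosed_le hu continuous_const)).inter
        (h.preimage continuous_tail)
    rw [e]
    refine ContinuousOn.union_of_isClosed (ContinuousOn.union_of_isClosed ?_ ?_
      (isClosed_Icc.prod d₀) (isClosed_Icc.prod d₁)) ?_
      ((isClosed_Icc.prod d₀).union (isClosed_Icc.prod d₁)) (isClosed_Icc.prod d)
    · exact continuousOn_const.congr fun p hp => low₂ _ _ hp.2
    · exact continuousOn_const.congr fun p hp => high₂ _ _ hp.2
    · refine hcont.comp (ContinuousOn.prodMk (Continuous.continuousOn (by fun_prop)) ?_) dom₂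
      exact cK.comp (Continuous.continuousOn (by fun_prop)) fun p hp => ⟨hp.1, hp.2.2⟩
  · rintro ⟨s, x⟩ ⟨hs, hx | hx | hx⟩
    · exact (congrArg (· ∈ glue A₀ A₁ B) (low₂ s x hx)).mpr (Or.inl ⟨rfl, ha₀⟩)
    · exact (congrArg (· ∈ glue A₀ A₁ B) (high₂ s x hx)).mpr (Or.inr (Or.inl ⟨rfl, ha₁⟩))
    · exact hmaps (dom₂ ⟨hs, hx⟩)
  · exact hcont.comp (Continuous.continuousOn (by fun_prop)) dom₃
  · rintro x (⟨hx, hm⟩ | ⟨hx, hm⟩ | ⟨hx, hm⟩) <;> simp only [mul_zero, add_zero, one_mul, sub_zero]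
    · rw [stretch_mid (by rw [hx]; norm_num) (z₀ _ hm), prepend, Fin.cons_self_tail]
    · rw [stretch_high (by rw [hx]) (z₁ _ hm), hx, sub_self, z₁ _ hm, prepend, ← hx,
        Fin.cons_self_tail]
    · rw [stretch_mid hx (z₀ _ (hB₀ hm)), prepend, Fin.cons_self_tail]
  · intro x hx
    have e : K (0, tail x) = tail x := by
      by_cases hv : tail x ∈ B
      exacts [zK _ hv, nK _ _ hv]
    simp only [e]
    norm_num
  · rintro x (hx | hx | hx)
    · refine (low₂ 1 x hx).trans ?_
      simp only [hx.1, mul_zero, zero_sub, low _ (hB₀ hb)]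
    · refine (high₂ 1 x hx).trans ?_
      simp only [hx.1, mul_one, sub_zero]
      rw [show (3 : ℝ) - 1 = 2 by norm_num, high _ (hB₁ hb)]
    · simp only [eK _ hx.2, sub_zero, one_mul]
  · intro x _
    simp only [sub_self, zero_mul, mul_zero, zero_sub, low _ (hB₀ hb)]

end

end JohnsonVR

namespace JohnsonVR

open Fin (tail cons)

lemma contractibleSpace_glue_empty {m : ℕ} (A : Set (Fin m → ℝ)) [ContractibleSpace A] :
    ContractibleSpace (glue ∅ A ∅) := by
  have hmem : ∀ x : glue ∅ A ∅, x.1 0 = 1 ∧ tail x.1 ∈ A := by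
    rintro ⟨x, ⟨-, h⟩ | h | ⟨-, h⟩⟩
    exacts [h.elim, h, h.elim]
  let e : glue ∅ A ∅ ≃ₜ A :=
    { toFun x := ⟨tail x.1, (hmem x).2⟩
      invFun v := ⟨prepend 1 v.1, Or.inr (Or.inl ⟨rfl, v.2⟩)⟩
      left_inv x := Subtype.ext (by
        show prepend 1 (tail x.1) = x.1
        rw [prepend, ← (hmem x).1, Fin.cons_self_tail])
      right_inv v := Subtype.ext (Fin.tail_cons (α := fun _ => ℝ) 1 v.1)
      continuous_toFun := (continuous_tail.comp continuous_subtype_val).subtype_mk _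
      continuous_invFun := ((continuous_prepend 1).comp continuous_subtype_val).subtype_mk _ }
  exact e.contractibleSpace

lemma contractibleSpace_of_eq_singleton {E : Type*} [TopologicalSpace E] {A : Set E} {a : E}
    (h : A = {a}) : ContractibleSpace A := by
  subst h
  exact (Homeomorph.homeomorphOfUnique _ Unit).contractibleSpace

lemma cubeTree_eq_empty {d m n : ℕ} (h : m + d < n) : cubeTree d m n = ∅ := by
  refine Set.eq_empty_of_subset_empty ((cubeTree_subset d m n).trans ?_)
  rintro x ⟨-, -, hx⟩
  have : #{i | x i = 1} ≤ m := by simpa using card_le_univ ({i | x i = 1} : Finset (Fin m))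
  omega

lemma contractibleSpace_cubeTree {d m n : ℕ} (h : n ≤ m + d) :
    ContractibleSpace (cubeTree d m n) := by
  induction m generalizing d n with
  | zero =>
    refine contractibleSpace_of_eq_singleton (a := 0) ?_
    ext x
    simp only [cubeTree, Set.mem_ofPred_eq, Set.mem_singleton_iff, Subsingleton.elim x 0, iff_true]
    omega
  | succ m ih =>
    cases n with
    | zero => exact contractibleSpace_of_eq_singleton (cubeTree_zero_right d (m + 1))
    | succ n =>
      cases d with
      | zero =>
        have := ih (d := 0) (n := n) (by omega)
        exact contractibleSpace_glue_empty _
      | succ d =>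
        have := ih (d := d + 1) (n := n) (by omega)
        rw [cubeTree]
        rcases (show n ≤ m + d ∨ m + d < n by omega) with hn | hn
        · have := ih (d := d + 1) (n := n + 1) (by omega)
          have := ih (d := d) (n := n) hn
          have hB := (cubeTree_subset d m n)
          exact contractibleSpace_glue (isClosed_cubeTree _ _ _) (isClosed_cubeTree _ _ _)
            (isClosed_cubeTree _ _ _) (hB.trans (cubeSlab_subset_cubeTree d m n).2)
            (hB.trans (cubeSlab_subset_cubeTree d m n).1)
        · rw [cubeTree_eq_empty (d := d) (m := m) (n := n) hn,
            cubeTree_eq_empty (d := d + 1) (n := n + 1) (by omega)]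
          exact contractibleSpace_glue_empty _

end JohnsonVR

namespace JohnsonVR

open scoped unitInterval
open Topology

/-- Collapsing a set that can be contracted inside itself by a deformation of the whole space is a
homotopy equivalence. -/
lemma nonempty_homotopyEquiv_of_collapse {X Y : Type*} [TopologicalSpace X] [TopologicalSpace Y]
    {A : Set X} {q : X → Y} (hq : IsQuotientMap q) (hqA : ∀ x ∈ A, ∀ y ∈ A, q x = q y)
    (hinj : ∀ x y, q x = q y → x = y ∨ x ∈ A ∧ y ∈ A) {H : I × X → X} (hc : Continuous H)
    (h0 : ∀ x, H (0, x) = x) (hA : ∀ t, ∀ x ∈ A, H (t, x) ∈ A) {a : X}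
    (h1 : ∀ x ∈ A, H (1, x) = a) : Nonempty (ContinuousMap.HomotopyEquiv X Y) := by
  let H₁ : C(X, X) := ⟨fun x => H (1, x), hc.comp (by fun_prop)⟩
  have hfac : Function.FactorsThrough H₁ q := by
    intro x y hxy
    rcases hinj x y hxy with rfl | ⟨hx, hy⟩
    exacts [rfl, (h1 x hx).trans (h1 y hy).symm]
  let Q : C(X, Y) := ⟨q, hq.continuous⟩
  let s : C(Y, X) := IsQuotientMap.lift (f := Q) hq H₁ hfac
  have hs : ∀ x, s (q x) = H (1, x) := fun x =>
    DFunLike.congr_fun (IsQuotientMap.lift_comp (f := Q) hq H₁ hfac) x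
  let G : I × Y → Y := fun p => q (H (p.1, Function.surjInv hq.surjective p.2))
  have hG : ∀ t x, G (t, q x) = q (H (t, x)) := by
    intro t x
    rcases hinj _ _ (Function.surjInv_eq hq.surjective (q x)) with e | ⟨hx, hy⟩
    · simp only [G, e]
    · exact hqA _ (hA t _ hx) _ (hA t _ hy)
  have hGc : Continuous G := hq.continuous_lift_prod_right (by
    simp only [hG]
    exact hq.continuous.comp hc)
  refine ⟨⟨Q, s, ⟨ContinuousMap.Homotopy.symm ⟨⟨H, hc⟩, fun x => ?_, fun x => ?_⟩⟩,
    ⟨ContinuousMap.Homotopy.symm ⟨⟨G, hGc⟩, fun y => ?_, fun y => ?_⟩⟩⟩⟩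
  · exact h0 x
  · exact (hs x).symm
  · obtain ⟨x, rfl⟩ := hq.surjective y
    exact (hG 0 x).trans (congrArg q (h0 x))
  · obtain ⟨x, rfl⟩ := hq.surjective y
    exact (hG 1 x).trans (congrArg q (hs x).symm)

end JohnsonVR

namespace JohnsonVR

lemma wrap_denom_pos (y : Fin 2 → ℝ) : 0 < y 0 ^ 2 + y 1 ^ 2 + (1 - ‖y‖) ^ 2 := by
  have h0 := sq_nonneg (y 0)
  have h1 := sq_nonneg (y 1)
  have h2 := sq_nonneg (1 - ‖y‖)
  refine lt_of_le_of_ne (by positivity) fun h => ?_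
  have e0 : y 0 = 0 := pow_eq_zero_iff two_ne_zero |>.1 (by linarith)
  have e1 : y 1 = 0 := pow_eq_zero_iff two_ne_zero |>.1 (by linarith)
  have : y = 0 := by ext k; fin_cases k <;> assumption
  subst this
  simp at h

/-- The map from the square to the sphere collapsing the boundary: inverse stereographic projection
of `y / (1 - ‖y‖)`. -/
noncomputable def wrap (y : Fin 2 → ℝ) : Sph 2 :=
  ⟨(y 0 ^ 2 + y 1 ^ 2 + (1 - ‖y‖) ^ 2)⁻¹ • !₂[y 0 ^ 2 + y 1 ^ 2 - (1 - ‖y‖) ^ 2,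
    2 * (1 - ‖y‖) * y 0, 2 * (1 - ‖y‖) * y 1], by
    have h := wrap_denom_pos y
    rw [mem_sphere_zero_iff_norm, norm_smul, EuclideanSpace.norm_eq, Fin.sum_univ_three]
    have e : (y 0 ^ 2 + y 1 ^ 2 - (1 - ‖y‖) ^ 2) ^ 2 + (2 * (1 - ‖y‖) * y 0) ^ 2 +
      (2 * (1 - ‖y‖) * y 1) ^ 2 = (y 0 ^ 2 + y 1 ^ 2 + (1 - ‖y‖) ^ 2) ^ 2 := by ring
    simp only [Real.norm_eq_abs, sq_abs, Matrix.cons_val_zero, Matrix.cons_val_one,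
      Matrix.cons_val_two, Matrix.head_cons, Matrix.tail_cons, e]
    rw [Real.sqrt_sq h.le, abs_of_pos (inv_pos.2 h), inv_mul_cancel₀ h.ne']⟩

lemma continuous_wrap : Continuous wrap := by
  refine Continuous.subtype_mk (Continuous.smul (Continuous.inv₀ (by fun_prop)
    fun y => (wrap_denom_pos y).ne') ?_) _
  refine (PiLp.continuous_toLp 2 _).comp (continuous_pi fun k => ?_)
  fin_cases k <;> simp <;> fun_prop

lemma ext_sph {s t : Sph 2} (h0 : s.1 0 = t.1 0) (h1 : s.1 1 = t.1 1) (h2 : s.1 2 = t.1 2) :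
    s = t := by
  refine Subtype.ext (PiLp.ext fun k => ?_)
  fin_cases k <;> assumption

lemma sph_sq_add (s : Sph 2) : s.1 0 ^ 2 + s.1 1 ^ 2 + s.1 2 ^ 2 = 1 := by
  have h := mem_sphere_zero_iff_norm.1 s.2
  rw [EuclideanSpace.norm_eq, Real.sqrt_eq_one, Fin.sum_univ_three] at h
  simpa using h

lemma eq_sphBase {s : Sph 2} (h : s.1 0 = 1) : s = sphBase 2 := by
  have hs := sph_sq_add s
  rw [h] at hs
  have h1 : s.1 1 = 0 := pow_eq_zero_iff two_ne_zero |>.1 (by nlinarith [sq_nonneg (s.1 2)])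
  have h2 : s.1 2 = 0 := pow_eq_zero_iff two_ne_zero |>.1 (by nlinarith [sq_nonneg (s.1 1)])
  refine ext_sph ?_ ?_ ?_ <;> simp [h, h1, h2, sphBase]

lemma wrap_zero (y : Fin 2 → ℝ) : (wrap y).1 0 =
    1 - 2 * (1 - ‖y‖) ^ 2 / (y 0 ^ 2 + y 1 ^ 2 + (1 - ‖y‖) ^ 2) := by
  have h := (wrap_denom_pos y).ne'
  simp only [wrap, PiLp.smul_apply, Matrix.cons_val_zero, smul_eq_mul]
  field_simp
  ring

lemma wrap_one (y : Fin 2 → ℝ) : (wrap y).1 1 =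
    2 * (1 - ‖y‖) * y 0 / (y 0 ^ 2 + y 1 ^ 2 + (1 - ‖y‖) ^ 2) := by
  simp [wrap, div_eq_inv_mul]

lemma wrap_two (y : Fin 2 → ℝ) : (wrap y).1 2 =
    2 * (1 - ‖y‖) * y 1 / (y 0 ^ 2 + y 1 ^ 2 + (1 - ‖y‖) ^ 2) := by
  simp [wrap, div_eq_inv_mul]

lemma wrap_eq_sphBase_iff {y : Fin 2 → ℝ} : wrap y = sphBase 2 ↔ ‖y‖ = 1 := by
  have h := (wrap_denom_pos y).ne'
  constructor
  · intro e
    have e0 : (wrap y).1 0 = 1 := by rw [e]; simp [sphBase]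
    rw [wrap_zero, sub_eq_self, div_eq_zero_iff, or_iff_left h] at e0
    have := pow_eq_zero_iff two_ne_zero |>.1 ((mul_eq_zero.1 e0).resolve_left two_ne_zero)
    linarith
  · intro e
    exact eq_sphBase (by rw [wrap_zero, e]; simp)

lemma wrap_inj {y z : Fin 2 → ℝ} (hy : ‖y‖ < 1) (hz : ‖z‖ < 1) (h : wrap y = wrap z) : y = z := by
  have hN := wrap_denom_pos y
  have hM := wrap_denom_pos z
  have h0 := congrArg (fun s : Sph 2 => s.1 0) h
  have h1 := congrArg (fun s : Sph 2 => s.1 1) h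
  have h2 := congrArg (fun s : Sph 2 => s.1 2) h
  simp only [wrap_zero, wrap_one, wrap_two] at h0 h1 h2
  set N := y 0 ^ 2 + y 1 ^ 2 + (1 - ‖y‖) ^ 2
  set M := z 0 ^ 2 + z 1 ^ 2 + (1 - ‖z‖) ^ 2
  have hv : 0 < 1 - ‖y‖ := by linarith
  have hw : 0 < 1 - ‖z‖ := by linarith
  set v := 1 - ‖y‖ with hv'
  set w := 1 - ‖z‖ with hw'
  have h0' : v ^ 2 / N = w ^ 2 / M := by
    rw [mul_div_assoc, mul_div_assoc] at h0
    linarith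
  have key : ∀ a b : ℝ, 2 * v * a / N = 2 * w * b / M → w * a = v * b := by
    intro a b hab
    have e : v ^ 2 * M = w ^ 2 * N := by field_simp at h0'; linarith
    have e' : v * a * M = w * b * N := by field_simp at hab; linarith
    have : (v * w * M) * (w * a) = (v * w * M) * (v * b) := by
      calc (v * w * M) * (w * a) = w ^ 2 * (v * a * M) := by ring
        _ = w * b * w ^ 2 * N := by rw [e']; ring
        _ = w * b * (v ^ 2 * M) := by rw [e]; ring
        _ = _ := by ring
    exact mul_left_cancel₀ (by positivity) this
  have hsmul : w • y = v • z := by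
    ext k
    fin_cases k
    exacts [key _ _ h1, key _ _ h2]
  have hnorm : w * ‖y‖ = v * ‖z‖ := by
    rw [← abs_of_pos hw, ← abs_of_pos hv, ← Real.norm_eq_abs, ← Real.norm_eq_abs, ← norm_smul,
      ← norm_smul, hsmul]
  have e : w = v := by
    have a1 : ‖y‖ = 1 - v := by rw [hv']; ring
    have a2 : ‖z‖ = 1 - w := by rw [hw']; ring
    rw [a1, a2] at hnorm
    linarith
  rw [e] at hsmul
  exact smul_right_injective _ hv.ne' hsmul

lemma exists_wrap_eq (s : Sph 2) : ∃ y : Fin 2 → ℝ, ‖y‖ ≤ 1 ∧ wrap y = s := by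
  by_cases hs : s.1 0 = 1
  · refine ⟨fun _ => 1, ?_, ?_⟩
    · simp
    · rw [eq_sphBase hs, wrap_eq_sphBase_iff]; simp
  have hsq := sph_sq_add s
  have h0 : s.1 0 < 1 := lt_of_le_of_ne
    (by nlinarith [sq_nonneg (s.1 1), sq_nonneg (s.1 2)]) hs
  set x : Fin 2 → ℝ := ![s.1 1 / (1 - s.1 0), s.1 2 / (1 - s.1 0)] with hx
  have hc : 0 < 1 + ‖x‖ := by positivity
  have hn : ‖(1 + ‖x‖)⁻¹ • x‖ = (1 + ‖x‖)⁻¹ * ‖x‖ := by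
    rw [norm_smul, Real.norm_eq_abs, abs_of_pos (inv_pos.2 hc)]
  have hw : 1 - ‖(1 + ‖x‖)⁻¹ • x‖ = (1 + ‖x‖)⁻¹ := by
    rw [hn]; field_simp; ring
  have hu : 0 < 1 - s.1 0 := by linarith
  have hN : ((1 + ‖x‖)⁻¹ * (s.1 1 / (1 - s.1 0))) ^ 2 + ((1 + ‖x‖)⁻¹ * (s.1 2 / (1 - s.1 0))) ^ 2 +
      (1 + ‖x‖)⁻¹ ^ 2 = (1 + ‖x‖)⁻¹ ^ 2 * 2 / (1 - s.1 0) := by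
    field_simp
    linear_combination hsq
  refine ⟨(1 + ‖x‖)⁻¹ • x, ?_, ext_sph ?_ ?_ ?_⟩
  · have := inv_pos.2 hc
    linarith
  · rw [wrap_zero, hw]
    simp only [Pi.smul_apply, hx, smul_eq_mul, Matrix.cons_val_zero, Matrix.cons_val_one]
    rw [← hx, hN]
    field_simp
    ring
  · rw [wrap_one, hw]
    simp only [Pi.smul_apply, hx, smul_eq_mul, Matrix.cons_val_zero, Matrix.cons_val_one]
    rw [← hx, hN]
    field_simp
  · rw [wrap_two, hw]
    simp only [Pi.smul_apply, hx, smul_eq_mul, Matrix.cons_val_zero, Matrix.cons_val_one]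
    rw [← hx, hN]
    field_simp

end JohnsonVR

namespace JohnsonVR

open scoped unitInterval
open Topology

section wedge

variable {c : ℕ} {X : Type} [TopologicalSpace X] {x₀ : X}

open Classical in
/-- The label of a point of a wedge: the point itself, unless it is the base point. -/
noncomputable def wedgeLabel : Wedge c X x₀ → Option (Fin c × X) :=
  Quot.lift (Sum.elim (fun _ => none) fun p => if p.2 = x₀ then none else some p) (by
    rintro _ _ ⟨i⟩
    simp)

lemma wedge_mk_base (i : Fin c) : (Quot.mk _ (Sum.inr (i, x₀)) : Wedge c X x₀) = wedgePt c X x₀ :=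
  (Quot.sound (wedgeRel.glue i)).symm

lemma wedge_mk_eq_wedgePt {p : Fin c × X}
    (h : (Quot.mk _ (Sum.inr p) : Wedge c X x₀) = wedgePt c X x₀) : p.2 = x₀ := by
  by_contra hp
  have := congrArg wedgeLabel h
  simp [wedgeLabel, wedgePt, hp] at this

lemma wedge_mk_inj {p r : Fin c × X} (hp : p.2 ≠ x₀)
    (h : (Quot.mk _ (Sum.inr p) : Wedge c X x₀) = Quot.mk _ (Sum.inr r)) : p = r := by
  have := congrArg wedgeLabel h
  by_cases hr : r.2 = x₀
  · simp [wedgeLabel, hp, hr] at this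
  · simpa [wedgeLabel, hp, hr] using this

end wedge

lemma continuous_prod_sum_dom {S A B Z : Type*} [TopologicalSpace S] [TopologicalSpace A]
    [TopologicalSpace B] [TopologicalSpace Z] {f : S × (A ⊕ B) → Z}
    (hA : Continuous fun p : S × A => f (p.1, Sum.inl p.2))
    (hB : Continuous fun p : S × B => f (p.1, Sum.inr p.2)) : Continuous f := by
  have : f ∘ (Homeomorph.prodSumDistrib (X := S) (Y := A) (Z := B)).symm =
      Sum.elim (fun p : S × A => f (p.1, Sum.inl p.2)) fun p : S × B => f (p.1, Sum.inr p.2) := by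
    ext (p | p) <;> rfl
  rw [← (Homeomorph.prodSumDistrib (X := S) (Y := A) (Z := B)).symm.comp_continuous_iff']
  rw [this]
  exact hA.sumElim hB

lemma continuous_prod_discrete_dom {S κ B Z : Type*} [TopologicalSpace S] [TopologicalSpace κ]
    [DiscreteTopology κ] [TopologicalSpace B] [TopologicalSpace Z] {f : S × (κ × B) → Z}
    (h : ∀ k, Continuous fun p : S × B => f (p.1, (k, p.2))) : Continuous f := by
  have : Continuous fun p : κ × (S × B) => f (p.2.1, (p.1, p.2.2)) :=
    continuous_prod_of_discrete_left.2 h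
  exact this.comp (by fun_prop : Continuous fun p : S × (κ × B) => (p.2.1, (p.1, p.2.2)))

namespace CellData

variable {d m : ℕ} {A X : Set (Fin m → ℝ)} {ι κ : Type}

/-- Relabel the cells. -/
def reindex (D : CellData d A X ι) (e : ι ≃ κ) : CellData d A X κ where
  char k := D.char (e.symm k)
  cont k := D.cont _
  mem k := D.mem _
  mem_iff k := D.mem_iff _
  inj k l y hy z hz h hyz := (D.inj _ _ y hy z hz h hyz).imp_left fun h => e.symm.injective h
  cover x hx h := by
    obtain ⟨i, y, hy, rfl⟩ := D.cover x hx h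
    exact ⟨e i, y, hy, by rw [e.symm_apply_apply]⟩

variable (D : CellData d A X ι)

/-- The characteristic map reparametrized by the unit ball of the sup norm. -/
noncomputable def cell (i : ι) (y : Fin d → ℝ) : Fin m → ℝ := D.char i fun k => (1 + y k) / 2

lemma continuous_cell (i : ι) : Continuous (D.cell i) := (D.cont i).comp (by fun_prop)

lemma half_mem_unitCube {y : Fin d → ℝ} (hy : ‖y‖ ≤ 1) : (fun k => (1 + y k) / 2) ∈ unitCube d := by
  intro k
  have := abs_le.1 ((norm_le_pi_norm y k).trans hy)
  constructor <;> simp only <;> linarith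

lemma cell_mem (i : ι) {y : Fin d → ℝ} (hy : ‖y‖ ≤ 1) : D.cell i y ∈ X :=
  D.mem i _ (half_mem_unitCube hy)

lemma cell_mem_iff (i : ι) {y : Fin d → ℝ} (hy : ‖y‖ ≤ 1) : D.cell i y ∈ A ↔ ‖y‖ = 1 := by
  rw [cell, D.mem_iff i _ (half_mem_unitCube hy)]
  have h1 : ‖y‖ = 1 ↔ ¬ ‖y‖ < 1 := ⟨fun h => h.not_lt, fun h => le_antisymm hy (not_lt.1 h)⟩
  rw [h1, pi_norm_lt_iff one_pos, not_forall]
  refine exists_congr fun k => ?_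
  have hk := abs_le.1 ((norm_le_pi_norm y k).trans hy)
  rw [Real.norm_eq_abs, abs_lt]
  constructor
  · rintro (h | h) ⟨h', h''⟩ <;> linarith
  · intro h
    by_contra! hne
    refine h ⟨lt_of_le_of_ne hk.1 fun h => hne.1 ?_, lt_of_le_of_ne hk.2 fun h => hne.2 ?_⟩ <;>
    linarith

lemma cell_inj {i j : ι} {y z : Fin d → ℝ} (hy : ‖y‖ ≤ 1) (hz : ‖z‖ ≤ 1) (h : D.cell i y ∉ A)
    (e : D.cell i y = D.cell j z) : i = j ∧ y = z := by
  obtain ⟨h1, h2⟩ := D.inj i j _ (half_mem_unitCube hy) _ (half_mem_unitCube hz) h e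
  refine ⟨h1, funext fun k => ?_⟩
  have := congrFun h2 k
  linarith

lemma exists_cell_eq {x : Fin m → ℝ} (hx : x ∈ X) (h : x ∉ A) :
    ∃ i, ∃ y, ‖y‖ ≤ 1 ∧ D.cell i y = x := by
  obtain ⟨i, y, hy, rfl⟩ := D.cover x hx h
  refine ⟨i, fun k => 2 * y k - 1, ?_, ?_⟩
  · rw [pi_norm_le_iff_of_nonneg zero_le_one]
    intro k
    have := hy k
    rw [Real.norm_eq_abs, abs_le]
    constructor <;> linarith
  · rw [cell]
    congr 1
    ext k
    ring

variable (F : ℝ × (Fin m → ℝ) → Fin m → ℝ)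

/-- Blow up a cell by the factor `1 + t`, letting the part beyond the boundary follow `F`. -/
noncomputable def blowUp (i : ι) (p : ℝ × (Fin d → ℝ)) : Fin m → ℝ :=
  if (1 + p.1) * ‖p.2‖ ≤ 1 then D.cell i ((1 + p.1) • p.2)
  else F ((1 + p.1) * ‖p.2‖ - 1, D.cell i (‖p.2‖⁻¹ • p.2))

variable {F}

lemma norm_inv_smul {y : Fin d → ℝ} (hy : ‖y‖ ≠ 0) : ‖‖y‖⁻¹ • y‖ = 1 := by
  rw [norm_smul, norm_inv, norm_norm, inv_mul_cancel₀ hy]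

lemma blowUp_of_ge (hF : ∀ v ∈ A, F (0, v) = v) (i : ι) {t : ℝ} {y : Fin d → ℝ}
    (h : 1 ≤ (1 + t) * ‖y‖) :
    D.blowUp F i (t, y) = F ((1 + t) * ‖y‖ - 1, D.cell i (‖y‖⁻¹ • y)) := by
  rcases h.eq_or_lt with h | h
  · have hy : ‖y‖ ≠ 0 := fun h' => by simp [h'] at h
    rw [blowUp, if_pos h.ge, ← h, sub_self, eq_inv_of_mul_eq_one_left h.symm,
      hF _ ((D.cell_mem_iff i (norm_inv_smul hy).le).2 (norm_inv_smul hy))]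
  · rw [blowUp, if_neg h.not_ge]

lemma continuousOn_blowUp (hF : ∀ v ∈ A, F (0, v) = v) (hc : ContinuousOn F (Set.Icc 0 1 ×ˢ A))
    (i : ι) : ContinuousOn (D.blowUp F i) (Set.Icc 0 1 ×ˢ Metric.closedBall 0 1) := by
  have hn : Continuous fun p : ℝ × (Fin d → ℝ) => (1 + p.1) * ‖p.2‖ := by fun_prop
  have e : (Set.Icc (0 : ℝ) 1 ×ˢ Metric.closedBall (0 : Fin d → ℝ) 1) =
      (Set.Icc (0 : ℝ) 1 ×ˢ Metric.closedBall (0 : Fin d → ℝ) 1) ∩ {p | (1 + p.1) * ‖p.2‖ ≤ 1} ∪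
      (Set.Icc (0 : ℝ) 1 ×ˢ Metric.closedBall (0 : Fin d → ℝ) 1) ∩ {p | 1 ≤ (1 + p.1) * ‖p.2‖} := by
    rw [← Set.inter_union_distrib_left, Set.left_eq_inter]
    exact fun p _ => le_total ((1 + p.1) * ‖p.2‖) 1
  have hcl := isClosed_Icc.prod (Metric.isClosed_closedBall (x := (0 : Fin d → ℝ)) (ε := 1))
    (s₁ := Set.Icc (0 : ℝ) 1)
  rw [e]
  refine ContinuousOn.union_of_isClosed ?_ ?_ (hcl.inter (isClosed_le hn continuous_const))
    (hcl.inter (isClosed_le continuous_const hn))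
  · exact ((D.continuous_cell i).comp (f := fun p : ℝ × (Fin d → ℝ) => (1 + p.1) • p.2)
      (by fun_prop)).continuousOn.congr fun p hp => if_pos hp.2
  · refine ContinuousOn.congr (f := fun p => F ((1 + p.1) * ‖p.2‖ - 1, D.cell i (‖p.2‖⁻¹ • p.2))) ?_
      fun p hp => D.blowUp_of_ge hF i hp.2
    have hne : ∀ p ∈ (Set.Icc (0 : ℝ) 1 ×ˢ Metric.closedBall (0 : Fin d → ℝ) 1) ∩
        {p | 1 ≤ (1 + p.1) * ‖p.2‖}, ‖p.2‖ ≠ 0 := by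
      rintro p ⟨-, hp⟩ h'
      rw [Set.mem_ofPred_eq, h', mul_zero] at hp
      linarith
    refine hc.comp (ContinuousOn.prodMk (by fun_prop) ((D.continuous_cell i).comp_continuousOn
      ((ContinuousOn.inv₀ (by fun_prop) hne).smul (by fun_prop)))) ?_
    rintro ⟨t, y⟩ hp
    have hn := norm_inv_smul (hne _ hp)
    obtain ⟨⟨⟨h0, h1⟩, hy⟩, h⟩ := hp
    have hy' : ‖y‖ ≤ 1 := by simpa using hy
    simp only [Set.mem_ofPred_eq] at h h0 h1
    refine ⟨⟨by simpa using h, ?_⟩, (D.cell_mem_iff i hn.le).2 hn⟩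
    simp only
    nlinarith [norm_nonneg y]

end CellData

end JohnsonVR

namespace JohnsonVR

open scoped unitInterval
open Topology

namespace CellData

section attach

variable {d m : ℕ} {A X : Set (Fin m → ℝ)} {κ : Type} (D : CellData d A X κ) (hAX : A ⊆ X)

/-- The map from the disjoint union of `A` and the cells onto `X`. -/
noncomputable def attach : A ⊕ κ × Metric.closedBall (0 : Fin d → ℝ) 1 → X :=
  Sum.elim (fun a => ⟨a, hAX a.2⟩)
    fun p => ⟨D.cell p.1 p.2, D.cell_mem _ (mem_closedBall_zero_iff.1 p.2.2)⟩

lemma attach_inr_mem_iff {p : κ × Metric.closedBall (0 : Fin d → ℝ) 1} :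
    (D.attach hAX (Sum.inr p)).1 ∈ A ↔ ‖p.2.1‖ = 1 :=
  D.cell_mem_iff _ (mem_closedBall_zero_iff.1 p.2.2)

lemma attach_inj {z w : A ⊕ κ × Metric.closedBall (0 : Fin d → ℝ) 1}
    (hz : (D.attach hAX z).1 ∉ A) (h : D.attach hAX z = D.attach hAX w) : z = w := by
  have hw := h ▸ hz
  rcases z with a | ⟨i, y⟩
  · exact absurd a.2 hz
  rcases w with b | ⟨j, w⟩
  · exact absurd b.2 hw
  obtain ⟨rfl, e⟩ := D.cell_inj (mem_closedBall_zero_iff.1 y.2) (mem_closedBall_zero_iff.1 w.2) hz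
    (congrArg Subtype.val h)
  rw [Subtype.ext e]

lemma attach_surjective : Function.Surjective (D.attach hAX) := by
  rintro ⟨x, hx⟩
  by_cases hxA : x ∈ A
  · exact ⟨Sum.inl ⟨x, hxA⟩, rfl⟩
  · obtain ⟨i, y, hy, rfl⟩ := D.exists_cell_eq hx hxA
    exact ⟨Sum.inr (i, ⟨y, mem_closedBall_zero_iff.2 hy⟩), rfl⟩

lemma continuous_attach [TopologicalSpace κ] [DiscreteTopology κ] : Continuous (D.attach hAX) := by
  refine Continuous.sumElim (continuous_subtype_val.subtype_mk _) (Continuous.subtype_mk ?_ _)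
  exact continuous_prod_of_discrete_left.2 fun i =>
    (D.continuous_cell i).comp continuous_subtype_val

lemma isQuotientMap_attach [TopologicalSpace κ] [DiscreteTopology κ] [Finite κ] (hX : IsCompact X)
    (hA : IsClosed A) : IsQuotientMap (D.attach hAX) := by
  have := isCompact_iff_compactSpace.1 (hX.of_isClosed_subset hA hAX)
  have := isCompact_iff_compactSpace.1 (isCompact_closedBall (0 : Fin d → ℝ) 1)
  exact IsQuotientMap.of_surjective_continuous (D.attach_surjective hAX) (D.continuous_attach hAX)

variable (F : ℝ × (Fin m → ℝ) → Fin m → ℝ)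

/-- The deformation of the disjoint union of `A` and the cells given by `F` and by blowing up. -/
noncomputable def spread (p : I × (A ⊕ κ × Metric.closedBall (0 : Fin d → ℝ) 1)) : Fin m → ℝ :=
  Sum.elim (fun a : A => F (p.1, a))
    (fun r : κ × Metric.closedBall (0 : Fin d → ℝ) 1 => D.blowUp F r.1 (p.1, r.2)) p.2

variable {F}

lemma continuous_spread [TopologicalSpace κ] [DiscreteTopology κ] (hF : ∀ v ∈ A, F (0, v) = v)
    (hc : ContinuousOn F (Set.Icc 0 1 ×ˢ A)) : Continuous (D.spread F) := by
  refine continuous_prod_sum_dom ?_ (continuous_prod_discrete_dom fun i => ?_)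
  · exact hc.comp_continuous (f := fun p : I × A => ((p.1 : ℝ), (p.2 : Fin m → ℝ))) (by fun_prop)
      fun p => ⟨p.1.2, p.2.2⟩
  · exact (D.continuousOn_blowUp hF hc i).comp_continuous
      (f := fun p : I × Metric.closedBall (0 : Fin d → ℝ) 1 => ((p.1 : ℝ), (p.2 : Fin d → ℝ)))
      (by fun_prop) fun p => ⟨p.1.2, p.2.2⟩

lemma spread_of_mem (hF : ∀ v ∈ A, F (0, v) = v) (t : I)
    {z : A ⊕ κ × Metric.closedBall (0 : Fin d → ℝ) 1} (hz : (D.attach hAX z).1 ∈ A) :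
    D.spread F (t, z) = F (t, (D.attach hAX z).1) := by
  rcases z with a | ⟨i, y⟩
  · rfl
  · have hy : ‖y.1‖ = 1 := (D.attach_inr_mem_iff hAX).1 hz
    refine (D.blowUp_of_ge hF i ?_).trans ?_
    · rw [hy, mul_one]
      linarith [t.2.1]
    · rw [hy, inv_one, one_smul, mul_one, add_sub_cancel_left]
      rfl

lemma spread_zero (hF : ∀ v ∈ A, F (0, v) = v)
    (z : A ⊕ κ × Metric.closedBall (0 : Fin d → ℝ) 1) :
    D.spread F (0, z) = (D.attach hAX z).1 := by
  rcases z with a | ⟨i, y⟩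
  · exact hF a a.2
  · have hy := mem_closedBall_zero_iff.1 y.2
    refine (if_pos (by simpa using hy)).trans ?_
    simp [attach]

lemma spread_mem (hAX : A ⊆ X) (hm : Set.MapsTo F (Set.univ ×ˢ A) A)
    (p : I × (A ⊕ κ × Metric.closedBall (0 : Fin d → ℝ) 1)) : D.spread F p ∈ X := by
  obtain ⟨t, a | ⟨i, y⟩⟩ := p
  · exact hAX (hm ⟨trivial, a.2⟩)
  · simp only [spread, Sum.elim_inr, blowUp]
    split_ifs with h
    · refine D.cell_mem _ ?_
      rwa [norm_smul, Real.norm_eq_abs, abs_of_nonneg (by linarith [t.2.1])]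
    · have hy : ‖y.1‖ ≠ 0 := fun h' => h (by rw [h']; simp)
      exact hAX (hm ⟨trivial, (D.cell_mem_iff i (norm_inv_smul hy).le).2 (norm_inv_smul hy)⟩)

end attach

variable {m c : ℕ} {A X : Set (Fin m → ℝ)}

/-- The map from the disjoint union of `A` and the cells onto the wedge of spheres. -/
noncomputable def collapse : A ⊕ Fin c × Metric.closedBall (0 : Fin 2 → ℝ) 1 → WedgeSph 2 c :=
  fun z => Quot.mk _ (Sum.map (fun _ => ()) (Prod.map id fun y => wrap y.1) z)

lemma isQuotientMap_collapse [Nonempty A] [CompactSpace A] :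
    IsQuotientMap (collapse : A ⊕ Fin c × Metric.closedBall (0 : Fin 2 → ℝ) 1 → WedgeSph 2 c) := by
  have := isCompact_iff_compactSpace.1 (isCompact_closedBall (0 : Fin 2 → ℝ) 1)
  refine isQuotientMap_quot_mk.comp (IsQuotientMap.of_surjective_continuous ?_ ?_)
  · refine Function.Surjective.sumMap (Function.surjective_to_subsingleton _)
      (Function.surjective_id.prodMap fun s => ?_)
    obtain ⟨y, hy, rfl⟩ := exists_wrap_eq s
    exact ⟨⟨y, mem_closedBall_zero_iff.2 hy⟩, rfl⟩
  · exact continuous_const.sumMap (continuous_id.prodMap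
      (continuous_wrap.comp continuous_subtype_val))

lemma collapse_inr_eq_iff {r : Fin c × Metric.closedBall (0 : Fin 2 → ℝ) 1} :
    collapse (A := A) (Sum.inr r) = wedgePt c (Sph 2) (sphBase 2) ↔ ‖r.2.1‖ = 1 := by
  rw [← wrap_eq_sphBase_iff]
  refine ⟨fun h => wedge_mk_eq_wedgePt h, fun h => ?_⟩
  have : collapse (A := A) (Sum.inr r) = Quot.mk _ (Sum.inr (r.1, wrap r.2.1)) := rfl
  rw [this, h, wedge_mk_base]

lemma collapse_eq_iff (D : CellData 2 A X (Fin c)) (hAX : A ⊆ X)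
    {z : A ⊕ Fin c × Metric.closedBall (0 : Fin 2 → ℝ) 1} :
    collapse z = wedgePt c (Sph 2) (sphBase 2) ↔ (D.attach hAX z).1 ∈ A := by
  rcases z with a | r
  · exact ⟨fun _ => a.2, fun _ => rfl⟩
  · rw [attach_inr_mem_iff, collapse_inr_eq_iff]

lemma collapse_inj {z w : A ⊕ Fin c × Metric.closedBall (0 : Fin 2 → ℝ) 1}
    (hz : collapse z ≠ wedgePt c (Sph 2) (sphBase 2)) (h : collapse z = collapse w) : z = w := by
  have hw := h ▸ hz
  rcases z with a | ⟨i, y⟩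
  · exact absurd rfl hz
  rcases w with b | ⟨j, w⟩
  · exact absurd rfl hw
  have hy := fun h => hz (collapse_inr_eq_iff.2 h)
  have hw' := fun h => hw (collapse_inr_eq_iff.2 h)
  have e := wedge_mk_inj (p := (i, wrap y.1)) (r := (j, wrap w.1))
    (fun h => hy (wrap_eq_sphBase_iff.1 h)) h
  rw [Prod.mk.injEq] at e
  rw [e.1, Subtype.ext (wrap_inj (lt_of_le_of_ne (mem_closedBall_zero_iff.1 y.2) hy)
    (lt_of_le_of_ne (mem_closedBall_zero_iff.1 w.2) hw') e.2)]

/-- A space obtained from a contractible one by attaching `c` two-dimensional cells is homotopy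
equivalent to a wedge of `c` spheres. -/
lemma nonempty_homotopyEquiv_wedgeSph (D : CellData 2 A X (Fin c)) (hAX : A ⊆ X)
    (hX : IsCompact X) (hA : IsClosed A) [ContractibleSpace A] :
    Nonempty (ContinuousMap.HomotopyEquiv X (WedgeSph 2 c)) := by
  obtain ⟨a, ha, F, hc, hm, h0, h1, -⟩ := exists_contraction A
  have : Nonempty A := ⟨⟨a, ha⟩⟩
  have := isCompact_iff_compactSpace.1 (hX.of_isClosed_subset hA hAX)
  have hp := D.isQuotientMap_attach hAX hX hA
  have hQ : IsQuotientMap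
      (collapse : A ⊕ Fin c × Metric.closedBall (0 : Fin 2 → ℝ) 1 → WedgeSph 2 c) :=
    isQuotientMap_collapse
  let q : X → WedgeSph 2 c := fun x => collapse (Function.surjInv hp.surjective x)
  have hq : ∀ z, q (D.attach hAX z) = collapse z := by
    intro z
    have e := Function.surjInv_eq hp.surjective (D.attach hAX z)
    by_cases hz : (D.attach hAX z).1 ∈ A
    · rw [(collapse_eq_iff D hAX).2 hz]
      exact (collapse_eq_iff D hAX).2 (e.symm ▸ hz)
    · exact congrArg collapse (D.attach_inj hAX hz e.symm).symm
  have hcomp : q ∘ D.attach hAX = collapse := funext hq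
  have hqq : IsQuotientMap q := IsQuotientMap.of_comp hp.continuous
    (hp.continuous_iff.2 (hcomp ▸ hQ.continuous)) (hcomp ▸ hQ)
  have hqA : ∀ x : X, q x = wedgePt c (Sph 2) (sphBase 2) ↔ x.1 ∈ A := by
    intro x
    obtain ⟨z, rfl⟩ := hp.surjective x
    rw [hq, collapse_eq_iff D hAX]
  let H : I × X → X := fun p =>
    ⟨D.spread F (p.1, Function.surjInv hp.surjective p.2), D.spread_mem hAX hm _⟩
  have hH : ∀ t z, (H (t, D.attach hAX z)).1 = D.spread F (t, z) := by
    intro t z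
    have e := Function.surjInv_eq hp.surjective (D.attach hAX z)
    by_cases hz : (D.attach hAX z).1 ∈ A
    · rw [D.spread_of_mem hAX h0 t hz]
      refine (D.spread_of_mem hAX h0 t (e.symm ▸ hz)).trans ?_
      rw [e]
    · exact congrArg (fun w => D.spread F (t, w)) (D.attach_inj hAX hz e.symm).symm
  have hHA : ∀ t, ∀ x : X, x.1 ∈ A → (H (t, x)).1 = F (t, x.1) := by
    intro t x hx
    obtain ⟨z, rfl⟩ := hp.surjective x
    rw [hH, D.spread_of_mem hAX h0 t hx]
  refine nonempty_homotopyEquiv_of_collapse (A := {x : X | x.1 ∈ A}) hqq ?_ ?_ (H := H) ?_ ?_ ?_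
    (a := ⟨a, hAX ha⟩) ?_
  · intro x hx y hy
    rw [(hqA x).2 hx, (hqA y).2 hy]
  · intro x y hxy
    by_cases hx : x.1 ∈ A
    · exact Or.inr ⟨hx, (hqA y).1 (hxy ▸ (hqA x).2 hx)⟩
    · left
      obtain ⟨z, rfl⟩ := hp.surjective x
      obtain ⟨w, rfl⟩ := hp.surjective y
      rw [hq, hq] at hxy
      rw [collapse_inj (fun h => hx ((collapse_eq_iff D hAX).1 h)) hxy]
  · refine hp.continuous_lift_prod_right (continuous_induced_rng.2 ?_)
    exact (D.continuous_spread h0 hc).congr fun p => (hH p.1 p.2).symm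
  · intro x
    obtain ⟨z, rfl⟩ := hp.surjective x
    exact Subtype.ext ((hH 0 z).trans (D.spread_zero hAX h0 z))
  · intro t x hx
    show (H (t, x)).1 ∈ A
    rw [hHA t x hx]
    exact hm ⟨trivial, hx⟩
  · intro x hx
    exact Subtype.ext ((hHA 1 x hx).trans (h1 _ hx))

end CellData

end JohnsonVR

namespace JohnsonVR

/-- The wedge of spheres attached to the middle cube slabs. -/
lemma nonempty_homotopyEquiv_cubeSlab_wedgeSph {m n : ℕ} (h : n ≤ m + 2) :
    Nonempty (ContinuousMap.HomotopyEquiv (cubeSlab 2 m n) (WedgeSph 2 (cellCount 2 m n))) := by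
  obtain ⟨ι, _, hι, ⟨D⟩⟩ := exists_cellData 2 m n
  have := contractibleSpace_cubeTree h
  exact (D.reindex (Fintype.equivFinOfCardEq hι)).nonempty_homotopyEquiv_wedgeSph
    (cubeTree_subset 2 m n) (isCompact_cubeSlab 2 m n) (isClosed_cubeTree 2 m n)

end JohnsonVR

/-- For `1 < n < m - 1`, `VR(F_n^m, 2)` is homotopy equivalent to a wedge
of `Σ_{k=2}^{n} C(m+k-1-n, k+1)·C(k,2)` copies of `S²`. -/
theorem stmt9 (m n : ℕ) (h1 : 1 < n) (h2 : n + 1 < m) :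
    AbsSC.HEquivTop (VRc (Fnm m n) 2)
      (WedgeSph 2 (∑ k ∈ Finset.Icc 2 n, Nat.choose (m + k - 1 - n) (k + 1) * k.choose 2)) := by
  obtain ⟨e₁⟩ := JohnsonVR.nonempty_homotopyEquiv_gapSet h1 h2
  obtain ⟨e₂⟩ := JohnsonVR.nonempty_homotopyEquiv_cubeSlab h1 h2
  obtain ⟨e₃⟩ := JohnsonVR.nonempty_homotopyEquiv_cubeSlab_wedgeSph (m := m) (n := n + 1) (by omega)
  rw [← JohnsonVR.cellCount_two]
  exact ⟨(e₁.trans e₂).trans e₃⟩
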